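/- arXiv:1603.07316 — 4 statements merged into one kernel-verified Lean document; each statement's English description precedes it below -/
import Mathlib

section
/- Let n₁,n₂ ≥ 2, 1 ≤ s₁ ≤ n₁, 1 ≤ s₂ ≤ n₂ and m ≥ 1. If there exists a stably (s₁,s₂)-injective linear map M : M(n₁,n₂) → ℂ^m, then m ≥ 2(n₁+n₂)−4 in the case s₁ = n₁ and s₂ = n₂, and m ≥ 2(s₁+s₂)−2 in all other cases. -/
noncomputable section

/-- A vector in `ℂⁿ` is `s`-sparse if it has at most `s` nonzero entries. -/
def Sparse {n : ℕ} (s : ℕ) (u : Fin n → ℂ) : Prop := {i | u i ≠ 0}.ncard ≤ s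

/-- `M¹_{s₁,s₂}(n₁,n₂)`: matrices of the form `u vᵗ` with `u` `s₁`-sparse and `v` `s₂`-sparse. -/
def M1 (n₁ n₂ s₁ s₂ : ℕ) : Set (Matrix (Fin n₁) (Fin n₂) ℂ) :=
  {X | ∃ u : Fin n₁ → ℂ, ∃ v : Fin n₂ → ℂ,
    Sparse s₁ u ∧ Sparse s₂ v ∧ X = Matrix.vecMulVec u v}

/-- `Δ(S) = {X - Y : X, Y ∈ S}`. -/
def diffSet {n₁ n₂ : ℕ} (S : Set (Matrix (Fin n₁) (Fin n₂) ℂ)) :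
    Set (Matrix (Fin n₁) (Fin n₂) ℂ) :=
  {Z | ∃ X ∈ S, ∃ Y ∈ S, Z = X - Y}

/-- Frobenius norm of a complex matrix. -/
def frob {a b : ℕ} (X : Matrix (Fin a) (Fin b) ℂ) : ℝ :=
  Real.sqrt (∑ i, ∑ j, ‖X i j‖ ^ 2)

/-- Euclidean norm of a vector in `ℂ^m`. -/
def l2 {m : ℕ} (v : Fin m → ℂ) : ℝ := Real.sqrt (∑ i, ‖v i‖ ^ 2)

/-- A (linear) map `M : M(n₁,n₂) → ℂ^m` is stably `(s₁,s₂)`-injective if there is `C > 0` with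
`‖M(X)‖₂ ≥ C ‖X‖_F` for all `X ∈ Δ(M¹_{s₁,s₂}(n₁,n₂))`. -/
def StablyInj (n₁ n₂ s₁ s₂ m : ℕ) (M : Matrix (Fin n₁) (Fin n₂) ℂ → (Fin m → ℂ)) : Prop :=
  ∃ C : ℝ, 0 < C ∧ ∀ X ∈ diffSet (M1 n₁ n₂ s₁ s₂), C * frob X ≤ l2 (M X)

def mnr {R α β : Type*} [CommRing R] (x : α → β → R) (i₁ i₂ i₃ : α) (j₁ j₂ j₃ : β) : R :=
  x i₁ j₁ * (x i₂ j₂ * x i₃ j₃ - x i₂ j₃ * x i₃ j₂)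
  - x i₁ j₂ * (x i₂ j₁ * x i₃ j₃ - x i₂ j₃ * x i₃ j₁)
  + x i₁ j₃ * (x i₂ j₁ * x i₃ j₂ - x i₂ j₂ * x i₃ j₁)

lemma mnr_map {R S α β : Type*} [CommRing R] [CommRing S] (f : R →+* S) (x : α → β → R)
    (i₁ i₂ i₃ : α) (j₁ j₂ j₃ : β) :
    f (mnr x i₁ i₂ i₃ j₁ j₂ j₃) = mnr (fun i j => f (x i j)) i₁ i₂ i₃ j₁ j₂ j₃ := by
  simp [mnr]

lemma rank_two_of_mnr {F α β : Type*} [Field F] (x : α → β → F)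
    (h : ∀ i₁ i₂ i₃ j₁ j₂ j₃, mnr x i₁ i₂ i₃ j₁ j₂ j₃ = 0) :
    ∃ (a c : α → F) (b d : β → F), ∀ i j, x i j = a i * b j + c i * d j := by
  by_cases h0 : ∀ i j, x i j = 0
  · exact ⟨0, 0, 0, 0, by simp [h0]⟩
  push Not at h0
  obtain ⟨i₀, j₀, h0⟩ := h0
  set y : α → β → F := fun i j => x i j - x i j₀ / x i₀ j₀ * x i₀ j with hy
  by_cases h1 : ∀ i j, y i j = 0
  · refine ⟨fun i => x i j₀ / x i₀ j₀, 0, fun j => x i₀ j, 0, fun i j => ?_⟩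
    have := h1 i j
    simp only [hy] at this
    simp
    linear_combination this
  push Not at h1
  obtain ⟨i₁, j₁, h1⟩ := h1
  refine ⟨fun i => x i j₀ / x i₀ j₀, fun i => y i j₁ / y i₁ j₁, fun j => x i₀ j,
    fun j => y i₁ j, fun i j => ?_⟩
  have key : y i j * y i₁ j₁ = y i j₁ * y i₁ j := by
    have := h i₀ i i₁ j₀ j j₁
    simp only [mnr] at this
    simp only [hy]
    field_simp
    linear_combination x i₀ j₀ * this
  have e : y i j = y i j₁ / y i₁ j₁ * y i₁ j := by
    field_simp
    linear_combination key
  have : x i j = x i j₀ / x i₀ j₀ * x i₀ j + y i j := by simp only [hy]; ring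
  rw [this, e]

lemma null {p q m : ℕ} (T : Fin m → Fin p → Fin q → ℂ)
    (hT : ∀ (a c : Fin p → ℂ) (b d : Fin q → ℂ),
      (∀ l, ∑ i, ∑ j, T l i j * (a i * b j + c i * d j) = 0) → ∀ i j, a i * b j + c i * d j = 0)
    {κ : Type*} [Field κ] (f : ℂ →+* κ) (y : Fin p → Fin q → κ)
    (hy : ∀ i₁ i₂ i₃ j₁ j₂ j₃, mnr y i₁ i₂ i₃ j₁ j₂ j₃ = 0)
    (hL : ∀ l, ∑ i, ∑ j, f (T l i j) * y i j = 0) (i j) : y i j = 0 := by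
  let P := MvPolynomial (Fin p × Fin q) ℂ
  let X : Fin p → Fin q → P := fun i j => MvPolynomial.X (i, j)
  let ev : P →+* κ := MvPolynomial.eval₂Hom f (fun ij => y ij.1 ij.2)
  have evX : ∀ i j, ev (X i j) = y i j := fun i j => MvPolynomial.eval₂Hom_X' f _ (i, j)
  have evC : ∀ z, ev (MvPolynomial.C z) = f z := fun z => MvPolynomial.eval₂Hom_C f _ z
  let I : Ideal P := RingHom.ker ev
  have hI : I.IsPrime := RingHom.ker_isPrime ev
  have hXI : X i j ∈ I := by
    rw [← MvPolynomial.IsPrime.vanishingIdeal_zeroLocus (K := ℂ) I,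
      MvPolynomial.mem_vanishingIdeal_iff]
    intro z hz
    rw [MvPolynomial.mem_zeroLocus_iff] at hz
    have h3 := fun i₁ i₂ i₃ j₁ j₂ j₃ => hz (mnr X i₁ i₂ i₃ j₁ j₂ j₃) (by
      change ev _ = 0
      rw [mnr_map]; simp only [evX]; exact hy ..)
    have h4 := fun l => hz (∑ i, ∑ j, MvPolynomial.C (T l i j) * X i j) (by
      change ev _ = 0
      simp only [map_sum, map_mul, evX, evC]
      exact hL l)
    have h5 : ∀ i₁ i₂ i₃ j₁ j₂ j₃, mnr (fun i j => z (i, j)) i₁ i₂ i₃ j₁ j₂ j₃ = 0 := by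
      intro i₁ i₂ i₃ j₁ j₂ j₃
      have := h3 i₁ i₂ i₃ j₁ j₂ j₃
      have e := mnr_map (MvPolynomial.aeval (R := ℂ) z).toRingHom X i₁ i₂ i₃ j₁ j₂ j₃
      simp only [AlgHom.toRingHom_eq_coe, RingHom.coe_coe] at e
      rw [e] at this
      simpa [X] using this
    obtain ⟨a, c, b, d, h⟩ := rank_two_of_mnr _ h5
    have := hT a c b d (fun l => by
      have := h4 l
      simp only [map_sum, map_mul, X, MvPolynomial.aeval_X, h] at this
      simpa using this) i j
    simp only [X, MvPolynomial.aeval_X, h, this]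
  have : ev (X i j) = 0 := hXI
  rwa [evX] at this

lemma integ {p q m : ℕ} (T : Fin m → Fin p → Fin q → ℂ)
    (hT : ∀ (a c : Fin p → ℂ) (b d : Fin q → ℂ),
      (∀ l, ∑ i, ∑ j, T l i j * (a i * b j + c i * d j) = 0) → ∀ i j, a i * b j + c i * d j = 0)
    {K : Type*} [Field K] (f : ℂ →+* K) (x : Fin p → Fin q → K)
    (hx : ∀ i₁ i₂ i₃ j₁ j₂ j₃, mnr x i₁ i₂ i₃ j₁ j₂ j₃ = 0)
    (R : Subring K) [IsIntegrallyClosedIn R K] (hR : ∀ c, f c ∈ R)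
    (hL : ∀ l, ∑ i, ∑ j, f (T l i j) * x i j ∈ R) (i j) : x i j ∈ R := by
  by_contra hcon
  obtain ⟨V, hRV, hV⟩ := Subring.exists_le_valuationSubring_of_isIntegrallyClosedIn hcon
  have : Nonempty (Fin p × Fin q) := ⟨(i, j)⟩
  obtain ⟨⟨i₀, j₀⟩, hmax⟩ := Finite.exists_max (fun s : Fin p × Fin q => V.valuation (x s.1 s.2))
  have h1 : 1 < V.valuation (x i₀ j₀) := by
    have := hmax (i, j)
    rw [← V.valuation_le_one_iff, not_le] at hV
    exact hV.trans_le this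
  have hx0 : x i₀ j₀ ≠ 0 := by
    intro h; rw [h] at h1; simp at h1
  have hmem : ∀ i j, x i j * (x i₀ j₀)⁻¹ ∈ V := by
    intro i j
    rw [← V.valuation_le_one_iff, map_mul, map_inv₀]
    have := hmax (i, j)
    exact mul_inv_le_one_of_le₀ this zero_le
  let y : Fin p → Fin q → V := fun i j => ⟨_, hmem i j⟩
  let g : ℂ →+* V := f.codRestrict V.toSubring (fun c => hRV (hR c))
  let r : V →+* IsLocalRing.ResidueField V := IsLocalRing.residue V
  have := null T hT (r.comp g) (fun i j => r (y i j)) (by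
      intro i₁ i₂ i₃ j₁ j₂ j₃
      rw [← mnr_map]
      convert map_zero r
      apply Subtype.ext
      have e := mnr_map V.subtype y i₁ i₂ i₃ j₁ j₂ j₃
      change ((mnr y i₁ i₂ i₃ j₁ j₂ j₃ : V) : K) = _ at e
      rw [e]
      have h := hx i₁ i₂ i₃ j₁ j₂ j₃
      simp only [mnr] at h ⊢
      change (x _ _ * _) * ((x _ _ * _) * (x _ _ * _) - (x _ _ * _) * (x _ _ * _)) 
        - (x _ _ * _) * ((x _ _ * _) * (x _ _ * _) - (x _ _ * _) * (x _ _ * _)) 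
        + (x _ _ * _) * ((x _ _ * _) * (x _ _ * _) - (x _ _ * _) * (x _ _ * _)) = 0
      linear_combination ((x i₀ j₀)⁻¹)^3 * h) (by
      intro l
      simp only [RingHom.comp_apply, ← map_mul, ← map_sum]
      rw [IsLocalRing.residue_eq_zero_iff, V.valuation_lt_one_iff]
      have e : ((∑ i, ∑ j, g (T l i j) * y i j : V) : K)
          = (∑ i, ∑ j, f (T l i j) * x i j) * (x i₀ j₀)⁻¹ := by
        change V.subtype _ = _
        simp only [map_sum, map_mul, Finset.sum_mul]
        refine Finset.sum_congr rfl fun i _ => Finset.sum_congr rfl fun j _ => ?_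
        change f _ * (x i j * _) = _
        ring
      rw [e, map_mul, map_inv₀]
      have h2 : V.valuation (∑ i, ∑ j, f (T l i j) * x i j) ≤ 1 :=
        (V.valuation_le_one_iff _).2 (hRV (hL l))
      exact (mul_le_of_le_one_left' h2).trans_lt (inv_lt_one_of_one_lt₀ h1)) i₀ j₀
  have e : y i₀ j₀ = 1 := Subtype.ext (mul_inv_cancel₀ hx0)
  simp [e] at this

open Algebra in
lemma key (p q m : ℕ) (T : Fin m → Fin (p+2) → Fin (q+2) → ℂ)
    (hT : ∀ (a c : Fin (p+2) → ℂ) (b d : Fin (q+2) → ℂ),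
      (∀ l, ∑ i, ∑ j, T l i j * (a i * b j + c i * d j) = 0) → ∀ i j, a i * b j + c i * d j = 0) :
    2 * (q+2) + 2 * p ≤ m := by
  let σ := (Fin 2 × Fin (q+2)) ⊕ (Fin 2 × Fin p)
  let B := MvPolynomial σ ℂ
  let K := FractionRing B
  let Z : σ → K := fun s => algebraMap B K (MvPolynomial.X s)
  let a : Fin (p+2) → K := Fin.cons 1 (Fin.cons 0 (fun i => Z (.inr (0, i))))
  let c : Fin (p+2) → K := Fin.cons 0 (Fin.cons 1 (fun i => Z (.inr (1, i))))
  let Y : Fin 2 → Fin (q+2) → K := fun s j => Z (.inl (s, j))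
  let x : Fin (p+2) → Fin (q+2) → K := fun i j => a i * Y 0 j + c i * Y 1 j
  let ℓ : Fin m → K := fun l => ∑ i, ∑ j, algebraMap ℂ K (T l i j) * x i j
  let S := Algebra.adjoin ℂ (Set.range ℓ)
  have hxint : ∀ i j, IsIntegral S (x i j) := by
    intro i j
    refine integ T hT (algebraMap ℂ K) x ?_ (integralClosure S K).toSubring ?_ ?_ i j
    · intros; simp only [mnr, x]; ring
    · intro z
      exact (integralClosure S K).algebraMap_mem (algebraMap ℂ S z)
    · intro l
      exact (integralClosure S K).algebraMap_mem ⟨ℓ l, Algebra.subset_adjoin ⟨l, rfl⟩⟩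
  let E := Subalgebra.algebraicClosure S K
  have hxE : ∀ i j, IsAlgebraic S (x i j) := fun i j => (hxint i j).isAlgebraic
  have hY0 : ∀ j, IsAlgebraic S (Y 0 j) := fun j => by
    have := hxE 0 j
    simpa [x, a, c] using this
  have hY1 : ∀ j, IsAlgebraic S (Y 1 j) := fun j => by
    have := hxE 1 j
    have e1 : a 1 = 0 := rfl
    have e2 : c 1 = 1 := rfl
    simpa [x, e1, e2] using this
  have hinj : Function.Injective Z := fun s t h =>
    MvPolynomial.X_injective (IsFractionRing.injective B K h)
  have hdet : Y 0 0 * Y 1 1 - Y 0 1 * Y 1 0 ≠ 0 := by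
    let D : B := MvPolynomial.X (.inl (0, 0)) * MvPolynomial.X (.inl (1, 1))
      - MvPolynomial.X (.inl (0, 1)) * MvPolynomial.X (.inl (1, 0))
    have hD : D ≠ 0 := by
      intro h
      have := congrArg (MvPolynomial.eval (Sum.elim (fun t : Fin 2 × Fin (q+2) => if (t.1 : ℕ) = t.2 then (1:ℂ) else 0) (fun _ => 0) : σ → ℂ)) h
      simp [D] at this
    have : algebraMap B K D ≠ 0 := by
      simpa using hD
    simpa [D, Y, Z] using this
  have hZ : ∀ s, IsAlgebraic S (Z s) := by
    rintro (⟨s, j⟩ | ⟨s, i⟩)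
    · fin_cases s
      · exact hY0 j
      · exact hY1 j
    · have e1 : ∀ j, x i.succ.succ j = Z (.inr (0, i)) * Y 0 j + Z (.inr (1, i)) * Y 1 j :=
        fun j => rfl
      have hd := ((hY0 0).mul (hY1 1)).sub ((hY0 1).mul (hY1 0))
      fin_cases s
      · have : Z (.inr (0, i)) = (x i.succ.succ 0 * Y 1 1 - x i.succ.succ 1 * Y 1 0) *
            (Y 0 0 * Y 1 1 - Y 0 1 * Y 1 0)⁻¹ := by
          rw [e1, e1, eq_mul_inv_iff_mul_eq₀ hdet]
          ring
        change IsAlgebraic S (Z (.inr (0, i)))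
        rw [this]
        exact (((hxE _ _).mul (hY1 1)).sub ((hxE _ _).mul (hY1 0))).mul hd.inv
      · have : Z (.inr (1, i)) = (x i.succ.succ 1 * Y 0 0 - x i.succ.succ 0 * Y 0 1) *
            (Y 0 0 * Y 1 1 - Y 0 1 * Y 1 0)⁻¹ := by
          rw [e1, e1, eq_mul_inv_iff_mul_eq₀ hdet]
          ring
        change IsAlgebraic S (Z (.inr (1, i)))
        rw [this]
        exact (((hxE _ _).mul (hY0 0)).sub ((hxE _ _).mul (hY0 1))).mul hd.inv
  have hB : ∀ b : B, IsAlgebraic S (algebraMap B K b) := by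
    intro b
    induction b using MvPolynomial.induction_on with
    | C z =>
      have : algebraMap B K (MvPolynomial.C z) = algebraMap S K (algebraMap ℂ S z) := rfl
      rw [this]; exact isAlgebraic_algebraMap _
    | add u v hu hv => rw [map_add]; exact hu.add hv
    | mul_X u s hu => rw [map_mul]; exact hu.mul (hZ s)
  have : Algebra.IsAlgebraic (Algebra.adjoin ℂ (Set.range ℓ)) K := by
    refine ⟨fun k => ?_⟩
    obtain ⟨u, v, hv, rfl⟩ := IsFractionRing.div_surjective (A := B) k
    rw [div_eq_mul_inv]
    exact (hB u).mul (hB v).inv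
  have h1 : trdeg ℂ K ≤ Cardinal.mk (Set.range ℓ) := Algebra.IsAlgebraic.trdeg_le_cardinalMk ℂ (Set.range ℓ)
  have h2 : trdeg ℂ B ≤ trdeg ℂ K :=
    trdeg_le_of_injective (IsScalarTower.toAlgHom ℂ B K) (IsFractionRing.injective B K)
  rw [MvPolynomial.trdeg_of_isDomain] at h2
  have h3 : Cardinal.mk (Set.range ℓ) ≤ Cardinal.mk (Fin m) := Cardinal.mk_range_le
  have h4 := (h2.trans h1).trans h3
  simp [σ] at h4
  norm_cast at h4

open Matrix

lemma frob_eq_zero {a b : ℕ} {X : Matrix (Fin a) (Fin b) ℂ} (h : frob X ≤ 0) : X = 0 := by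
  have h0 : ∑ i, ∑ j, ‖X i j‖ ^ 2 ≤ 0 := Real.sqrt_eq_zero'.1 (le_antisymm h (Real.sqrt_nonneg _))
  have h1 : ∀ i j, ‖X i j‖ ^ 2 ≤ 0 := by
    intro i j
    refine le_trans ?_ h0
    refine le_trans ?_ (Finset.single_le_sum (f := fun i => ∑ j, ‖X i j‖ ^ 2)
      (fun i _ => by positivity) (Finset.mem_univ i))
    exact Finset.single_le_sum (f := fun j => ‖X i j‖ ^ 2)
      (fun i _ => by positivity) (Finset.mem_univ j)
  ext i j
  have := h1 i j
  have h2 : ‖X i j‖ ^ 2 = 0 := le_antisymm this (by positivity)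
  simpa using h2

lemma l2_zero {m : ℕ} : l2 (0 : Fin m → ℂ) = 0 := by simp [l2]

lemma frob_cont {a b : ℕ} : Continuous (frob : Matrix (Fin a) (Fin b) ℂ → ℝ) := by
  unfold frob
  refine Real.continuous_sqrt.comp ?_
  refine continuous_finsetSum _ fun i _ => continuous_finsetSum _ fun j _ => ?_
  exact (continuous_norm.comp (continuous_id.matrix_elem i j)).pow 2

lemma l2_cont {m : ℕ} : Continuous (l2 : (Fin m → ℂ) → ℝ) := by
  unfold l2
  fun_prop

lemma ker_of_le {n₁ n₂ m : ℕ} (M : Matrix (Fin n₁) (Fin n₂) ℂ →ₗ[ℂ] (Fin m → ℂ)) {C : ℝ}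
    (hC : 0 < C) {X} (h : C * frob X ≤ l2 (M X)) (h0 : M X = 0) : X = 0 := by
  rw [h0, l2_zero] at h
  exact frob_eq_zero (by nlinarith [Real.sqrt_nonneg (∑ i, ∑ j, ‖X i j‖ ^ 2)])

/-- extension by zero -/
def ext0 {p n : ℕ} (a : Fin p → ℂ) : Fin n → ℂ := fun i => if h : (i : ℕ) < p then a ⟨i, h⟩ else 0

lemma sum_ext0 {p n : ℕ} (h : p ≤ n) {A : Type*} [AddCommMonoid A] (F : Fin n → A)
    (hF : ∀ i : Fin n, p ≤ i → F i = 0) : ∑ i, F i = ∑ i : Fin p, F (Fin.castLE h i) := by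
  symm
  refine Finset.sum_of_injOn (Fin.castLE h) (Fin.castLE_injective h).injOn (by simp) ?_ (by simp)
  intro i _ hi
  apply hF
  by_contra hlt
  push Not at hlt
  exact hi ⟨⟨i, hlt⟩, by simp, rfl⟩

lemma single_lin {n₁ n₂ m : ℕ} (M : Matrix (Fin n₁) (Fin n₂) ℂ →ₗ[ℂ] (Fin m → ℂ)) (i j) (z : ℂ)
    (l : Fin m) : M (Matrix.single i j z) l = M (Matrix.single i j 1) l * z := by
  have : Matrix.single i j z = z • (Matrix.single i j 1 : Matrix (Fin n₁) (Fin n₂) ℂ) := by simp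
  rw [this, map_smul, Pi.smul_apply, smul_eq_mul, mul_comm]

lemma core (n₁ n₂ p q m : ℕ) (hp : 2 ≤ p) (hpn : p ≤ n₁) (hq : 2 ≤ q) (hqn : q ≤ n₂)
    (M : Matrix (Fin n₁) (Fin n₂) ℂ →ₗ[ℂ] (Fin m → ℂ))
    (hM : ∀ (a c : Fin n₁ → ℂ) (b d : Fin n₂ → ℂ),
      (∀ i, p ≤ i.val → a i = 0) → (∀ i, p ≤ i.val → c i = 0) →
      (∀ i, q ≤ i.val → b i = 0) → (∀ i, q ≤ i.val → d i = 0) →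
      M (vecMulVec a b + vecMulVec c d) = 0 → vecMulVec a b + vecMulVec c d = 0) :
    2 * (p + q) - 4 ≤ m := by
  obtain ⟨p, rfl⟩ := Nat.exists_eq_add_of_le' hp
  obtain ⟨q, rfl⟩ := Nat.exists_eq_add_of_le' hq
  have := key p q m (fun l i j => M (Matrix.single (Fin.castLE hpn i) (Fin.castLE hqn j) 1) l) ?_
  · omega
  intro a c b d h i j
  have hz : ∀ {p n : ℕ} (a : Fin p → ℂ) (i : Fin n), p ≤ i.val → (ext0 a : Fin n → ℂ) i = 0 := by
    intro p n a i hi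
    simp [ext0, hi]
  have hc : ∀ {p n : ℕ} (h : p ≤ n) (a : Fin p → ℂ) (i : Fin p), (ext0 a : Fin n → ℂ) (Fin.castLE h i) = a i := by
    intro p n h a i
    simp [ext0]
  have h0 := hM (ext0 a) (ext0 c) (ext0 b) (ext0 d) (hz a) (hz c) (hz b) (hz d) (by
    ext l
    have e := Matrix.matrix_eq_sum_single (vecMulVec (ext0 a) (ext0 b) + vecMulVec (ext0 c) (ext0 d) : Matrix (Fin n₁) (Fin n₂) ℂ)
    rw [e]
    refine Eq.trans ?_ (h l)
    simp only [map_sum, Finset.sum_apply]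
    rw [sum_ext0 hpn]
    · refine Finset.sum_congr rfl fun i _ => ?_
      rw [sum_ext0 hqn]
      · refine Finset.sum_congr rfl fun j _ => ?_
        rw [single_lin]
        simp [vecMulVec_apply, hc]
      · intro j hj
        simp [vecMulVec_apply, hz _ _ hj]
    · intro i hi
      simp [vecMulVec_apply, hz _ _ hi])
  have := congrFun (congrFun h0 (Fin.castLE hpn i)) (Fin.castLE hqn j)
  simpa [vecMulVec_apply, hc] using this

lemma sparse_of {n : ℕ} {s : ℕ} (S : Finset (Fin n)) (hS : S.card ≤ s) {u : Fin n → ℂ}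
    (h : ∀ i, i ∉ S → u i = 0) : Sparse s u := by
  unfold Sparse
  refine le_trans ?_ hS
  rw [← Set.ncard_coe_finset]
  refine Set.ncard_le_ncard ?_ (Finset.finite_toSet S)
  intro i hi
  by_contra h'
  exact hi (h i h')

lemma card_lt_fin (n p : ℕ) (h : p ≤ n) : (Finset.univ.filter fun i : Fin n => i.val < p).card = p := by
  rw [Fin.card_filter_val_lt]; omega

lemma sparse_supp {n s : ℕ} (h : s ≤ n) {u : Fin n → ℂ} (hu : ∀ i, s ≤ i.val → u i = 0) :
    Sparse s u := by
  refine sparse_of _ (card_lt_fin n s h).le fun i hi => hu i ?_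
  simpa using hi

lemma sparse_supp' {n s : ℕ} (h : s + 1 ≤ n) {u : Fin n → ℂ} (hu : ∀ i, s + 1 ≤ i.val → u i = 0)
    (k : Fin n) (hk : k.val < s + 1) (huk : u k = 0) : Sparse s u := by
  refine sparse_of ((Finset.univ.filter fun i : Fin n => i.val < s + 1).erase k) ?_ fun i hi => ?_
  · rw [Finset.card_erase_of_mem (by simpa using hk), card_lt_fin n _ h]; simp
  · by_cases hik : i = k
    · rw [hik, huk]
    · apply hu
      simp [hik] at hi
      omega

lemma fin_bad (a c k : ℂ) : {t : ℂ | (a + t) * (c + t) - k = 0}.Finite := by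
  let P : Polynomial ℂ := (Polynomial.C a + Polynomial.X) * (Polynomial.C c + Polynomial.X) - Polynomial.C k
  have hev : ∀ t, P.eval t = (a + t) * (c + t) - k := by intro t; simp [P]
  have hP : P ≠ 0 := by
    intro h
    have h1 := hev 1
    have h2 := hev (-1)
    have h3 := hev 0
    simp only [h, Polynomial.eval_zero] at h1 h2 h3
    have : (2 : ℂ) = 0 := by linear_combination -h1 - h2 + 2 * h3
    norm_num at this
  refine (Polynomial.finite_setOfPred_isRoot hP).subset ?_
  intro t ht
  simpa [Polynomial.IsRoot, hev] using ht

lemma nonfull1 (n₁ n₂ s₁ s₂ m : ℕ) (hs₁ : 1 ≤ s₁) (hs₁n : s₁ < n₁) (hs₂ : 2 ≤ s₂) (hs₂n : s₂ ≤ n₂)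
    (M : Matrix (Fin n₁) (Fin n₂) ℂ →ₗ[ℂ] (Fin m → ℂ)) (h : StablyInj n₁ n₂ s₁ s₂ m M) :
    2 * (s₁ + s₂) - 2 ≤ m := by
  obtain ⟨C, hC, h⟩ := h
  have := core n₁ n₂ (s₁ + 1) s₂ m (by omega) hs₁n hs₂ hs₂n M ?_
  · omega
  intro a c b d ha hc hb hd h0
  refine ker_of_le M hC ?_ h0
  let i0 : Fin n₁ := ⟨0, by omega⟩
  let i1 : Fin n₁ := ⟨1, by omega⟩
  have h01 : i0 ≠ i1 := by simp [i0, i1]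
  let A : ℂ → Fin n₁ → ℂ := fun t => a + t • Pi.single i0 1
  let B : ℂ → Fin n₁ → ℂ := fun t => c + t • Pi.single i1 1
  let X : ℂ → Matrix (Fin n₁) (Fin n₂) ℂ := fun t => vecMulVec (A t) b + vecMulVec (B t) d
  have hXc : Continuous X := by
    refine Continuous.add ?_ ?_
    · exact Continuous.matrix_vecMulVec (by fun_prop) continuous_const
    · exact Continuous.matrix_vecMulVec (by fun_prop) continuous_const
  have hMc : Continuous M := M.continuous_of_finiteDimensional
  have hcl : IsClosed {t | C * frob (X t) ≤ l2 (M (X t))} :=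
    isClosed_le (continuous_const.mul (frob_cont.comp hXc)) (l2_cont.comp (hMc.comp hXc))
  have hdense : Dense {t : ℂ | (a i0 + t) * (c i1 + t) - a i1 * c i0 = 0}ᶜ :=
    (fin_bad _ _ _).countable.dense_compl ℂ
  have hsub : {t : ℂ | (a i0 + t) * (c i1 + t) - a i1 * c i0 = 0}ᶜ ⊆
      {t | C * frob (X t) ≤ l2 (M (X t))} := by
    intro t ht
    apply h
    have e00 : A t i0 = a i0 + t := by simp [A]
    have e01 : A t i1 = a i1 := by simp [A, h01.symm]
    have e10 : B t i0 = c i0 := by simp [B, h01]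
    have e11 : B t i1 = c i1 + t := by simp [B]
    have hD : A t i0 * B t i1 - A t i1 * B t i0 ≠ 0 := by
      rw [e00, e01, e10, e11]; exact ht
    have hA : ∀ i, s₁ + 1 ≤ i.val → A t i = 0 := by
      intro i hi
      have : i ≠ i0 := by rintro rfl; simp [i0] at hi
      simp [A, this, ha i hi]
    have hB : ∀ i, s₁ + 1 ≤ i.val → B t i = 0 := by
      intro i hi
      have : i ≠ i1 := by rintro rfl; simp [i1] at hi; omega
      simp [B, this, hc i hi]
    set D := A t i0 * B t i1 - A t i1 * B t i0 with hDdef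
    refine ⟨_, ⟨B t i1 • A t - A t i1 • B t, D⁻¹ • (A t i0 • b + B t i0 • d), ?_, ?_, rfl⟩,
      _, ⟨B t i0 • A t - A t i0 • B t, D⁻¹ • (A t i1 • b + B t i1 • d), ?_, ?_, rfl⟩, ?_⟩
    · refine sparse_supp' hs₁n (fun i hi => by simp [hA i hi, hB i hi]) i1 (by simp [i1]; omega) ?_
      simp; ring
    · exact sparse_supp hs₂n (fun i hi => by simp [hb i hi, hd i hi])
    · refine sparse_supp' hs₁n (fun i hi => by simp [hA i hi, hB i hi]) i0 (by simp [i0]) ?_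
      simp; ring
    · exact sparse_supp hs₂n (fun i hi => by simp [hb i hi, hd i hi])
    · ext i j
      simp only [X, vecMulVec_apply, Matrix.add_apply, Matrix.sub_apply, Pi.smul_apply,
        Pi.sub_apply, Pi.add_apply, smul_eq_mul]
      field_simp
      rw [hDdef]
      ring
  have hall := hcl.closure_subset_iff.2 hsub (hdense 0)
  simpa [X, A, B] using hall

lemma nonfull2 (n₁ n₂ s₁ m : ℕ) (hs₁n : s₁ ≤ n₁) (hn₂ : 2 ≤ n₂)
    (M : Matrix (Fin n₁) (Fin n₂) ℂ →ₗ[ℂ] (Fin m → ℂ)) (h : StablyInj n₁ n₂ s₁ 1 m M) :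
    2 * s₁ ≤ m := by
  obtain ⟨C, hC, h⟩ := h
  let j0 : Fin n₂ := ⟨0, by omega⟩
  let j1 : Fin n₂ := ⟨1, by omega⟩
  have h01 : j0 ≠ j1 := by simp [j0, j1]
  let E : (Fin s₁ → ℂ) →ₗ[ℂ] (Fin n₁ → ℂ) :=
    { toFun := ext0
      map_add' := by intro a b; ext i; simp only [ext0, Pi.add_apply]; split_ifs <;> simp
      map_smul' := by intro a b; ext i; simp only [ext0, Pi.smul_apply]; split_ifs <;> simp }
  let F : ((Fin s₁ → ℂ) × (Fin s₁ → ℂ)) →ₗ[ℂ] Matrix (Fin n₁) (Fin n₂) ℂ :=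
    { toFun := fun w => vecMulVec (E w.1) (Pi.single j0 1) - vecMulVec (E w.2) (Pi.single j1 1)
      map_add' := by
        intro v w; ext i j; simp [vecMulVec_apply]; ring
      map_smul' := by
        intro v w; ext i j; simp [vecMulVec_apply]; ring }
  have hsp : ∀ j : Fin n₂, Sparse 1 (Pi.single j 1 : Fin n₂ → ℂ) := by
    intro j
    refine sparse_of {j} (by simp) fun i hi => ?_
    simp at hi
    simp [hi]
  have hE : ∀ w, Sparse s₁ (E w) := fun w =>
    sparse_supp hs₁n (fun i hi => by simp [E, ext0, hi])
  have hinj : Function.Injective (M ∘ₗ F) := by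
    rw [← LinearMap.ker_eq_bot, LinearMap.ker_eq_bot']
    intro w hw
    have hF : F w = 0 := ker_of_le M hC
      (h _ ⟨_, ⟨_, _, hE w.1, hsp j0, rfl⟩, _, ⟨_, _, hE w.2, hsp j1, rfl⟩, rfl⟩) hw
    refine Prod.ext ?_ ?_
    · ext i
      have := congrFun (congrFun hF (Fin.castLE hs₁n i)) j0
      simpa [F, E, ext0, vecMulVec_apply, h01] using this
    · ext i
      have := congrFun (congrFun hF (Fin.castLE hs₁n i)) j1
      simpa [F, E, ext0, vecMulVec_apply, h01.symm] using this
  have := LinearMap.finrank_le_finrank_of_injective hinj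
  simp at this
  omega

lemma nonfull (n₁ n₂ s₁ s₂ m : ℕ) (hn₂ : 2 ≤ n₂)
    (hs₁ : 1 ≤ s₁) (hs₁n : s₁ < n₁) (hs₂ : 1 ≤ s₂) (hs₂n : s₂ ≤ n₂)
    (M : Matrix (Fin n₁) (Fin n₂) ℂ →ₗ[ℂ] (Fin m → ℂ)) (h : StablyInj n₁ n₂ s₁ s₂ m M) :
    2 * (s₁ + s₂) - 2 ≤ m := by
  obtain rfl | h2 : s₂ = 1 ∨ 2 ≤ s₂ := by omega
  · have := nonfull2 n₁ n₂ s₁ m hs₁n.le hn₂ M h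
    omega
  · exact nonfull1 n₁ n₂ s₁ s₂ m hs₁ hs₁n h2 hs₂n M h

lemma frob_transpose {a b : ℕ} (X : Matrix (Fin a) (Fin b) ℂ) : frob Xᵀ = frob X := by
  unfold frob
  rw [Finset.sum_comm]
  rfl

lemma stab_transpose {n₁ n₂ s₁ s₂ m : ℕ} (M : Matrix (Fin n₁) (Fin n₂) ℂ →ₗ[ℂ] (Fin m → ℂ))
    (h : StablyInj n₁ n₂ s₁ s₂ m M) :
    StablyInj n₂ n₁ s₂ s₁ m (M ∘ₗ (Matrix.transposeLinearEquiv (Fin n₂) (Fin n₁) ℂ ℂ).toLinearMap) := by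
  obtain ⟨C, hC, h⟩ := h
  refine ⟨C, hC, ?_⟩
  rintro _ ⟨_, ⟨u, v, hu, hv, rfl⟩, _, ⟨u', v', hu', hv', rfl⟩, rfl⟩
  have := h (vecMulVec v u - vecMulVec v' u') ⟨_, ⟨v, u, hv, hu, rfl⟩, _, ⟨v', u', hv', hu', rfl⟩, rfl⟩
  have e : (vecMulVec u v - vecMulVec u' v')ᵀ = vecMulVec v u - vecMulVec v' u' := by
    simp [Matrix.transpose_vecMulVec]
  rw [← e, frob_transpose] at this
  exact this

theorem stmt0 (n₁ n₂ s₁ s₂ m : ℕ) (hn₁ : 2 ≤ n₁) (hn₂ : 2 ≤ n₂)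
    (hs₁ : 1 ≤ s₁) (hs₁n : s₁ ≤ n₁) (hs₂ : 1 ≤ s₂) (hs₂n : s₂ ≤ n₂) (hm : 1 ≤ m)
    (hex : ∃ M : Matrix (Fin n₁) (Fin n₂) ℂ →ₗ[ℂ] (Fin m → ℂ),
      StablyInj n₁ n₂ s₁ s₂ m M) :
    if s₁ = n₁ ∧ s₂ = n₂ then 2 * (n₁ + n₂) - 4 ≤ m else 2 * (s₁ + s₂) - 2 ≤ m := by
  obtain ⟨M, hM⟩ := hex
  split_ifs with hf
  · obtain ⟨rfl, rfl⟩ := hf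
    obtain ⟨C, hC, h⟩ := hM
    refine core s₁ s₂ s₁ s₂ m hn₁ le_rfl hn₂ le_rfl M ?_
    intro a c b d ha hc hb hd h0
    refine ker_of_le M hC (h _ ⟨_, ⟨a, b, sparse_supp le_rfl ha, sparse_supp le_rfl hb, rfl⟩, _,
      ⟨-c, d, sparse_supp le_rfl (fun i hi => by simp [hc i hi]), sparse_supp le_rfl hd, rfl⟩, ?_⟩) h0
    rw [Matrix.neg_vecMulVec, sub_neg_eq_add]
  · by_cases h1 : s₁ < n₁
    · exact nonfull n₁ n₂ s₁ s₂ m hn₂ hs₁ h1 hs₂ hs₂n M hM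
    · have h2 : s₂ < n₂ := by omega
      have := nonfull n₂ n₁ s₂ s₁ m hn₁ hs₂ h2 hs₁ hs₁n _ (stab_transpose M hM)
      omega
end
end

section
/- Let n₁,n₂ ≥ 2, 1 ≤ s₁ ≤ n₁, 1 ≤ s₂ ≤ n₂, and suppose m ≥ 2(n₁+n₂)−4 if s₁ = n₁ and s₂ = n₂, and m ≥ 2(s₁+s₂)−2 otherwise. Then for Lebesgue-almost every m-tuple Y = (Y₁,…,Y_m) of complex n₂×n₁ matrices, the linear map M_Y : M(n₁,n₂) → ℂ^m defined by M_Y(X) = (tr(Y₁X),…,tr(Y_mX)) is stably (s₁,s₂)-injective. -/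
noncomputable section

open MeasureTheory


open MeasureTheory Topology Filter

lemma haar_aux {ι E : Type*} [Fintype ι] [NormedAddCommGroup E] [NormedSpace ℝ E]
    [FiniteDimensional ℝ E] [MeasureSpace E] [BorelSpace E]
    [(volume : Measure E).IsAddHaarMeasure] :
    (volume : Measure (ι → E)).IsAddHaarMeasure := by
  have : ProperSpace E := FiniteDimensional.proper ℝ E
  rw [volume_pi]; infer_instance

lemma null_lem {m n₁ n₂ : ℕ} (φ : (Fin m → ℂ) → Matrix (Fin n₁) (Fin n₂) ℂ)
    (hφ : ∀ i j, Differentiable ℝ (fun x => φ x i j))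
    (hE : ∀ x, φ x ≠ 0 → ∃ v : Fin m → ℂ, v ≠ 0 ∧ ∀ t : ℝ, φ (x + t • v) = (1 + (t:ℂ)) • φ x) :
    (volume : Measure (Fin m → Fin n₂ → Fin n₁ → ℂ))
      {Y | ∃ x, φ x ≠ 0 ∧ ∀ k, Matrix.trace (Matrix.of (Y k) * φ x) = 0} = 0 := by
  classical
  let F : Fin n₁ → Fin n₂ → (Fin m → Fin n₂ → Fin n₁ → ℂ) → (Fin m → Fin n₂ → Fin n₁ → ℂ) :=
    fun i j Y k b a => Y k b a - if b = j ∧ a = i then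
      (∑ b', ∑ a', Y k b' a' * φ (fun k => Y k j i) a' b') / φ (fun k => Y k j i) i j else 0
  let s : Fin n₁ → Fin n₂ → Set (Fin m → Fin n₂ → Fin n₁ → ℂ) :=
    fun i j => {Y | φ (fun k => Y k j i) i j ≠ 0}
  let V : Fin n₁ → Fin n₂ → (Fin m → ℂ) → (Fin m → Fin n₂ → Fin n₁ → ℂ) :=
    fun i j v k b a => if b = j ∧ a = i then v k else 0
  have htr : ∀ (Z : Fin n₂ → Fin n₁ → ℂ) (X : Matrix (Fin n₁) (Fin n₂) ℂ),
      Matrix.trace (Matrix.of Z * X) = ∑ b', ∑ a', Z b' a' * X a' b' := by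
    intro Z X
    simp [Matrix.trace, Matrix.mul_apply]
  have hVsum : ∀ i j v k (X : Matrix (Fin n₁) (Fin n₂) ℂ),
      ∑ b', ∑ a', V i j v k b' a' * X a' b' = v k * X i j := by
    intro i j v k X
    simp only [V]
    rw [Finset.sum_eq_single j, Finset.sum_eq_single i]
    · simp
    · intro a _ ha; simp [ha]
    · simp
    · intro b _ hb; simp [hb]
    · simp
  have hsub : {Y : Fin m → Fin n₂ → Fin n₁ → ℂ |
      ∃ x, φ x ≠ 0 ∧ ∀ k, Matrix.trace (Matrix.of (Y k) * φ x) = 0} ⊆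
      ⋃ i, ⋃ j, F i j '' s i j := by
    rintro Y ⟨x, hx, hY⟩
    obtain ⟨i, j, hij⟩ : ∃ i j, φ x i j ≠ 0 := by
      by_contra! h
      exact hx (by ext i j; simpa using h i j)
    simp only [Set.mem_iUnion]
    refine ⟨i, j, Y + V i j (fun k => x k - Y k j i), ?_, ?_⟩
    · have : (fun k => (Y + V i j (fun k => x k - Y k j i)) k j i) = x := by
        funext k; simp [V]
      simp only [s, Set.mem_ofPred_eq, this]
      exact hij
    · have h1 : (fun k => (Y + V i j (fun k => x k - Y k j i)) k j i) = x := by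
        funext k; simp [V]
      funext k b a
      simp only [F, h1]
      have h2 := hY k
      rw [htr] at h2
      simp only [Pi.add_apply, add_mul, Finset.sum_add_distrib, hVsum, h2]
      by_cases h : b = j ∧ a = i
      · simp [V, h, hij]
      · simp [V, h]
  refine measure_mono_null hsub ?_
  rw [measure_iUnion_null_iff]; intro i
  rw [measure_iUnion_null_iff]; intro j
  have hx : ∀ k, Differentiable ℝ (fun Y : Fin m → Fin n₂ → Fin n₁ → ℂ => Y k) := by
    intro k; fun_prop
  have hd : ∀ Y ∈ s i j, DifferentiableAt ℝ (F i j) Y := by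
    intro Y hY
    rw [differentiableAt_pi]; intro k
    rw [differentiableAt_pi]; intro b
    rw [differentiableAt_pi]; intro a
    simp only [F]
    have hφ' : ∀ a b, DifferentiableAt ℝ
        (fun Y : Fin m → Fin n₂ → Fin n₁ → ℂ => φ (fun k => Y k j i) a b) Y := by
      intro a b
      exact ((hφ a b) _).comp Y (f := fun Y : Fin m → Fin n₂ → Fin n₁ → ℂ => fun k => Y k j i)
        (by fun_prop)
    split_ifs
    · refine DifferentiableAt.sub (by fun_prop) ?_
      simp only [div_eq_mul_inv]
      refine DifferentiableAt.mul ?_ ((hφ' i j).inv hY)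
      refine DifferentiableAt.fun_sum fun b _ => DifferentiableAt.fun_sum fun a _ => ?_
      exact DifferentiableAt.mul (by fun_prop) (hφ' _ _)
    · fun_prop
  have h1 : (volume : Measure (Fin n₁ → ℂ)).IsAddHaarMeasure := haar_aux
  have h2 : (volume : Measure (Fin n₂ → Fin n₁ → ℂ)).IsAddHaarMeasure := haar_aux
  have h3 : (volume : Measure (Fin m → Fin n₂ → Fin n₁ → ℂ)).IsAddHaarMeasure := haar_aux
  refine addHaar_image_eq_zero_of_det_fderivWithin_eq_zero volume
    (f' := fun Y => fderiv ℝ (F i j) Y) (fun Y hY => (hd Y hY).hasFDerivAt.hasFDerivWithinAt) ?_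
  intro Y hY
  obtain ⟨v, hv0, hv⟩ := hE (fun k => Y k j i) (by intro h; apply hY; simp [h])
  have hker : fderiv ℝ (F i j) Y (V i j v) = 0 := by
    have h1 : HasDerivAt (fun t : ℝ => Y + t • V i j v) (V i j v) 0 := by
      simpa using ((hasDerivAt_id (0:ℝ)).smul_const (V i j v)).const_add Y
    have h0 : HasFDerivAt (F i j) (fderiv ℝ (F i j) Y) (Y + (0:ℝ) • V i j v) := by
      simpa using (hd Y hY).hasFDerivAt
    have h2 := h0.comp_hasDerivAt (0:ℝ) h1
    have h3 : HasDerivAt (F i j ∘ fun t : ℝ => Y + t • V i j v) 0 0 := by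
      refine (hasDerivAt_const (0:ℝ) (F i j Y)).congr_of_eventuallyEq ?_
      have : ∀ᶠ t : ℝ in 𝓝 0, t ≠ -1 := by
        apply IsOpen.mem_nhds isOpen_ne; norm_num
      filter_upwards [this] with t ht
      have ht' : (1 + (t:ℂ)) ≠ 0 := by
        intro h; apply ht
        have : ((1 + t : ℝ) : ℂ) = 0 := by push_cast; exact h
        have := Complex.ofReal_eq_zero.1 this
        linarith
      have e1 : (fun k => (Y + t • V i j v) k j i) = (fun k => Y k j i) + t • v := by
        funext k; simp [V]
      have hY' : φ (fun k => Y k j i) i j ≠ 0 := hY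
      funext k b a
      simp only [F, Function.comp, e1, hv]
      have e2 : ∑ b', ∑ a', (Y + t • V i j v) k b' a' *
          ((1 + (t:ℂ)) • φ (fun k => Y k j i)) a' b' =
          (1 + (t:ℂ)) * (∑ b', ∑ a', Y k b' a' * φ (fun k => Y k j i) a' b'
            + t * (v k * φ (fun k => Y k j i) i j)) := by
        rw [← hVsum]
        simp only [Finset.mul_sum, ← Finset.sum_add_distrib]
        refine Finset.sum_congr rfl fun b _ => Finset.sum_congr rfl fun a _ => ?_
        simp; ring
      rw [e2]
      by_cases h : b = j ∧ a = i
      · simp [V, h]; field_simp; ring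
      · simp [V, h]
    exact h2.unique h3
  by_contra hdet
  have hu : IsUnit (LinearMap.det ((fderiv ℝ (F i j) Y : _ →L[ℝ] _) :
      (Fin m → Fin n₂ → Fin n₁ → ℂ) →ₗ[ℝ] (Fin m → Fin n₂ → Fin n₁ → ℂ))) :=
    isUnit_iff_ne_zero.2 hdet
  have hinj := LinearMap.ker_eq_bot.1 (((LinearMap.isUnit_iff_isUnit_det _).2 hu |> fun h => (LinearMap.isUnit_iff_ker_eq_bot _).1 h))
  have : V i j v = 0 := hinj (by simpa using hker)
  apply hv0
  funext k
  simpa [V] using congrFun (congrFun (congrFun this k) j) i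

open Topology Filter

def InForm {n₁ n₂ : ℕ} (N : ℕ) (X : Matrix (Fin n₁) (Fin n₂) ℂ) : Prop :=
  ∃ (i k : Fin n₁) (c : Bool) (P P' : Finset (Fin n₁)) (Q Q' : Finset (Fin n₂))
    (p a : Fin n₁ → ℂ) (b q : Fin n₂ → ℂ),
    P.card + P'.card + Q.card + Q'.card ≤ N ∧ p i = 1 ∧
    (∀ l, l ∉ P → p l = (Pi.single i 1 : Fin n₁ → ℂ) l) ∧
    (∀ l, l ∉ P' → a l = (Pi.single k (if c then 1 else 0) : Fin n₁ → ℂ) l) ∧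
    (∀ j, j ∉ Q → b j = 0) ∧ (∀ j, j ∉ Q' → q j = 0) ∧
    ∀ l j, X l j = p l * b j + a l * q j

lemma null_param {n₁ n₂ m : ℕ} (p₀ a₀ : Fin n₁ → ℂ) (P P' : Finset (Fin n₁))
    (Q Q' : Finset (Fin n₂)) (hc : P.card + P'.card + Q.card + Q'.card ≤ m) :
    ∀ᵐ Y ∂(volume : Measure (Fin m → Fin n₂ → Fin n₁ → ℂ)),
      ∀ (p a : Fin n₁ → ℂ) (b q : Fin n₂ → ℂ) (X : Matrix (Fin n₁) (Fin n₂) ℂ),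
      (∀ l, l ∉ P → p l = p₀ l) → (∀ l, l ∉ P' → a l = a₀ l) →
      (∀ j, j ∉ Q → b j = 0) → (∀ j, j ∉ Q' → q j = 0) →
      (∀ l j, X l j = p l * b j + a l * q j) → X ≠ 0 →
      ¬ ∀ k, Matrix.trace (Matrix.of (Y k) * X) = 0 := by
  classical
  obtain ⟨ι⟩ : Nonempty (((P ⊕ P') ⊕ (Q ⊕ Q')) ↪ Fin m) := by
    apply Function.Embedding.nonempty_of_card_le
    simp; omega
  let pf : (Fin m → ℂ) → Fin n₁ → ℂ := fun x l =>
    if h : l ∈ P then x (ι (Sum.inl (Sum.inl ⟨l, h⟩))) else p₀ l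
  let af : (Fin m → ℂ) → Fin n₁ → ℂ := fun x l =>
    if h : l ∈ P' then x (ι (Sum.inl (Sum.inr ⟨l, h⟩))) else a₀ l
  let bf : (Fin m → ℂ) → Fin n₂ → ℂ := fun x l =>
    if h : l ∈ Q then x (ι (Sum.inr (Sum.inl ⟨l, h⟩))) else 0
  let qf : (Fin m → ℂ) → Fin n₂ → ℂ := fun x l =>
    if h : l ∈ Q' then x (ι (Sum.inr (Sum.inr ⟨l, h⟩))) else 0
  let φ : (Fin m → ℂ) → Matrix (Fin n₁) (Fin n₂) ℂ := fun x =>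
    Matrix.of fun l j => pf x l * bf x j + af x l * qf x j
  have hnull := null_lem φ ?_ ?_
  · rw [ae_iff]
    refine measure_mono_null ?_ hnull
    intro Y hY
    simp only [not_forall, Set.mem_ofPred_eq] at hY
    obtain ⟨p, a, b, q, X, hp, ha, hb, hq, hX, hX0, hY⟩ := hY
    replace hY := not_exists_not.1 hY
    let x : Fin m → ℂ := Function.extend ι
      (Sum.elim (Sum.elim (fun l => p l) (fun l => a l)) (Sum.elim (fun l => b l) (fun l => q l))) 0
    have hx : φ x = X := by
      ext l j
      rw [hX]
      have e1 : pf x l = p l := by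
        by_cases h : l ∈ P
        · simp [pf, h, x, ι.injective.extend_apply]
        · simp [pf, h, hp]
      have e2 : af x l = a l := by
        by_cases h : l ∈ P'
        · simp [af, h, x, ι.injective.extend_apply]
        · simp [af, h, ha]
      have e3 : bf x j = b j := by
        by_cases h : j ∈ Q
        · simp [bf, h, x, ι.injective.extend_apply]
        · simp [bf, h, hb]
      have e4 : qf x j = q j := by
        by_cases h : j ∈ Q'
        · simp [qf, h, x, ι.injective.extend_apply]
        · simp [qf, h, hq]
      simp [φ, e1, e2, e3, e4]
    exact ⟨x, hx ▸ hX0, hx ▸ hY⟩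
  · intro l j
    have h1 : Differentiable ℝ (fun x => pf x l) := by
      by_cases h : l ∈ P <;> simp only [pf, h, dite_true, dite_false] <;> fun_prop
    have h2 : Differentiable ℝ (fun x => af x l) := by
      by_cases h : l ∈ P' <;> simp only [af, h, dite_true, dite_false] <;> fun_prop
    have h3 : Differentiable ℝ (fun x => bf x j) := by
      by_cases h : j ∈ Q <;> simp only [bf, h, dite_true, dite_false] <;> fun_prop
    have h4 : Differentiable ℝ (fun x => qf x j) := by
      by_cases h : j ∈ Q' <;> simp only [qf, h, dite_true, dite_false] <;> fun_prop
    simp only [φ, Matrix.of_apply]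
    exact (h1.mul h3).add (h2.mul h4)
  · intro x hx
    let v : Fin m → ℂ := fun y => if ∃ r, ι (Sum.inr r) = y then x y else 0
    have hvl : ∀ r, v (ι (Sum.inl r)) = 0 := by
      intro r; simp [v]
    have hvr : ∀ r, v (ι (Sum.inr r)) = x (ι (Sum.inr r)) := by
      intro r; simp only [v]; rw [if_pos ⟨r, rfl⟩]
    refine ⟨v, ?_, ?_⟩
    · intro hv
      apply hx
      have h3 : ∀ j, bf x j = 0 := by
        intro j
        by_cases h : j ∈ Q
        · simp only [bf, h, dite_true]; rw [← hvr, hv]; rfl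
        · simp [bf, h]
      have h4 : ∀ j, qf x j = 0 := by
        intro j
        by_cases h : j ∈ Q'
        · simp only [qf, h, dite_true]; rw [← hvr, hv]; rfl
        · simp [qf, h]
      ext l j; simp [φ, h3, h4]
    · intro t
      ext l j
      have e1 : pf (x + t • v) l = pf x l := by
        by_cases h : l ∈ P <;> simp [pf, h, hvl]
      have e2 : af (x + t • v) l = af x l := by
        by_cases h : l ∈ P' <;> simp [af, h, hvl]
      have e3 : bf (x + t • v) j = (1 + (t:ℂ)) * bf x j := by
        by_cases h : j ∈ Q
        · simp [bf, h, hvr]; ring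
        · simp [bf, h]
      have e4 : qf (x + t • v) j = (1 + (t:ℂ)) * qf x j := by
        by_cases h : j ∈ Q'
        · simp [qf, h, hvr]; ring
        · simp [qf, h]
      simp [φ, e1, e2, e3, e4]; ring

lemma ae_form {n₁ n₂ m : ℕ} :
    ∀ᵐ Y ∂(volume : Measure (Fin m → Fin n₂ → Fin n₁ → ℂ)),
      ∀ X : Matrix (Fin n₁) (Fin n₂) ℂ, InForm m X → X ≠ 0 →
      ¬ ∀ k, Matrix.trace (Matrix.of (Y k) * X) = 0 := by
  have h : ∀ᵐ Y ∂(volume : Measure (Fin m → Fin n₂ → Fin n₁ → ℂ)),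
      ∀ (i k : Fin n₁) (c : Bool) (P P' : Finset (Fin n₁)) (Q Q' : Finset (Fin n₂))
        (_ : P.card + P'.card + Q.card + Q'.card ≤ m),
      ∀ (p a : Fin n₁ → ℂ) (b q : Fin n₂ → ℂ) (X : Matrix (Fin n₁) (Fin n₂) ℂ),
      (∀ l, l ∉ P → p l = (Pi.single i 1 : Fin n₁ → ℂ) l) →
      (∀ l, l ∉ P' → a l = (Pi.single k (if c then 1 else 0) : Fin n₁ → ℂ) l) →
      (∀ j, j ∉ Q → b j = 0) → (∀ j, j ∉ Q' → q j = 0) →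
      (∀ l j, X l j = p l * b j + a l * q j) → X ≠ 0 →
      ¬ ∀ k, Matrix.trace (Matrix.of (Y k) * X) = 0 := by
    rw [ae_all_iff]; intro i
    rw [ae_all_iff]; intro k
    rw [ae_all_iff]; intro c
    rw [ae_all_iff]; intro P
    rw [ae_all_iff]; intro P'
    rw [ae_all_iff]; intro Q
    rw [ae_all_iff]; intro Q'
    rw [ae_all_iff]; intro hc
    exact null_param _ _ P P' Q Q' hc
  filter_upwards [h] with Y hY X hX
  obtain ⟨i, k, c, P, P', Q, Q', p, a, b, q, hc, _, hp, ha, hb, hq, hX⟩ := hX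
  exact hY i k c P P' Q Q' hc p a b q X hp ha hb hq hX

lemma full_form {n₁ n₂ N : ℕ} (hn₁ : 2 ≤ n₁) {X : Matrix (Fin n₁) (Fin n₂) ℂ}
    (h : InForm N X) : InForm (2 * (n₁ + n₂) - 4) X := by
  classical
  obtain ⟨i, -, -, -, -, -, -, p, a, b, q, -, hp, -, -, -, -, hX⟩ := h
  have hcard : ∀ k, k ≠ i → (({i, k} : Finset (Fin n₁))ᶜ).card + (({i, k} : Finset (Fin n₁))ᶜ).card
      + (Finset.univ : Finset (Fin n₂)).card + (Finset.univ : Finset (Fin n₂)).card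
      ≤ 2 * (n₁ + n₂) - 4 := by
    intro k hk
    rw [Finset.card_compl, Finset.card_pair hk.symm]
    simp; omega
  by_cases hD : ∃ k, a k - p k * a i ≠ 0
  · obtain ⟨k, hk⟩ := hD
    have hki : k ≠ i := by
      rintro rfl; apply hk; rw [hp]; ring
    refine ⟨i, k, true, _, _, _, _, fun l => (p l * a k - a l * p k) / (a k - p k * a i),
      fun l => (a l - p l * a i) / (a k - p k * a i), X i, X k, hcard k hki, ?_, ?_, ?_, ?_, ?_, ?_⟩
    · simp only [hp]; rw [one_mul, mul_comm (a i)]; exact div_self hk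
    · intro l hl
      have hl : l = i ∨ l = k := by simpa [or_iff_not_imp_left] using hl
      rcases hl with rfl | rfl
      · simp only [hp, Pi.single_eq_same]; rw [one_mul, mul_comm (a l)]; exact div_self hk
      · simp [hki, mul_comm]
    · intro l hl
      have hl : l = i ∨ l = k := by simpa [or_iff_not_imp_left] using hl
      rcases hl with rfl | rfl
      · simp [hp, hki.symm]
      · simp [hk]
    · simp
    · simp
    · intro l j
      simp only [hX, hp]
      field_simp
      ring
  · push Not at hD
    obtain ⟨k, hki⟩ : ∃ k, k ≠ i := by
      have : Nontrivial (Fin n₁) := Fin.nontrivial_iff_two_le.2 hn₁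
      exact exists_ne i
    refine ⟨i, k, true, _, _, _, _, Function.update p k 0,
      Pi.single k 1, X i, X k, hcard k hki, ?_, ?_, ?_, ?_, ?_, ?_⟩
    · simp [hki.symm, hp]
    · intro l hl
      have hl : l = i ∨ l = k := by simpa [or_iff_not_imp_left] using hl
      rcases hl with rfl | rfl
      · simp [hp, hki.symm]
      · simp [hki]
    · simp
    · simp
    · simp
    · intro l j
      by_cases hl : l = k
      · subst hl; simp
      · simp only [hl, Function.update_of_ne, Pi.single_eq_of_ne, ne_eq, not_false_eq_true, hX, hp]
        have := hD l
        linear_combination q j * this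

lemma norm_M1 {n₁ n₂ s₁ s₂ : ℕ} (hn : 0 < n₁) (hs₁ : 1 ≤ s₁) {X : Matrix (Fin n₁) (Fin n₂) ℂ}
    (hX : X ∈ M1 n₁ n₂ s₁ s₂) :
    ∃ (i : Fin n₁) (S : Finset (Fin n₁)) (T : Finset (Fin n₂)) (u : Fin n₁ → ℂ) (v : Fin n₂ → ℂ),
      S.card ≤ s₁ ∧ T.card ≤ s₂ ∧ i ∈ S ∧ u i = 1 ∧ (∀ l, ‖u l‖ ≤ 1) ∧ (∀ l, l ∉ S → u l = 0) ∧
      (∀ j, j ∉ T → v j = 0) ∧ ∀ l j, X l j = u l * v j := by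
  classical
  obtain ⟨u, v, hu, hv, rfl⟩ := hX
  have : Nonempty (Fin n₁) := ⟨⟨0, hn⟩⟩
  obtain ⟨i, hi⟩ := Finite.exists_max (fun l => ‖u l‖)
  by_cases h0 : u i = 0
  · have hu0 : ∀ l, u l = 0 := by
      intro l; have := hi l; simpa [h0] using this
    refine ⟨i, {i}, ∅, Pi.single i 1, 0, by simpa, by simp, by simp, by simp, ?_, ?_, by simp, ?_⟩
    · intro l; by_cases h : l = i
      · subst h; simp
      · simp [h]
    · intro l hl; simp at hl; simp [hl]
    · intro l j; simp [Matrix.vecMulVec_apply, hu0]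
  · refine ⟨i, Finset.univ.filter (fun l => u l ≠ 0), Finset.univ.filter (fun l => v l ≠ 0),
      fun l => u l / u i, fun j => u i * v j, ?_, ?_, by simpa, by simp [h0], ?_, ?_, ?_, ?_⟩
    · unfold Sparse at hu
      rw [← Set.ncard_coe_finset]; simpa using hu
    · unfold Sparse at hv
      rw [← Set.ncard_coe_finset]; simpa using hv
    · intro l; rw [norm_div]; exact div_le_one_of_le₀ (hi l) (norm_nonneg _)
    · intro l hl; simp at hl; simp [hl]
    · intro l hl; simp at hl; simp [hl]
    · intro l j; rw [Matrix.vecMulVec_apply]; field_simp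

lemma ultra_const {α β : Type*} [Finite β] (U : Ultrafilter α) (f : α → β) :
    ∃ c, ∀ᶠ x in (U : Filter α), f x = c := by
  obtain ⟨c, -, hc⟩ := Ultrafilter.eq_pure_of_finite_mem (f := U.map f) (Set.finite_univ) univ_mem
  refine ⟨c, ?_⟩
  have : {c} ∈ U.map f := by rw [hc]; exact Ultrafilter.mem_pure.2 rfl
  exact this

lemma ultra_lim {α : Type*} {n : ℕ} (U : Ultrafilter α) (u : α → Fin n → ℂ)
    (h : ∀ᶠ x in (U : Filter α), ∀ l, ‖u x l‖ ≤ 1) :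
    ∃ u₀ : Fin n → ℂ, ∀ l, Tendsto (fun x => u x l) U (𝓝 (u₀ l)) := by
  have hmem : Metric.closedBall (0 : Fin n → ℂ) 1 ∈ U.map u := by
    have : ∀ᶠ x in (U : Filter α), u x ∈ Metric.closedBall (0 : Fin n → ℂ) 1 := by
      filter_upwards [h] with x hx
      rw [mem_closedBall_zero_iff]
      exact (pi_norm_le_iff_of_nonneg zero_le_one).2 hx
    exact this
  obtain ⟨u₀, -, hu⟩ := isCompact_iff_ultrafilter_le_nhds'.1
    (isCompact_closedBall (0 : Fin n → ℂ) 1) _ hmem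
  refine ⟨u₀, ?_⟩
  have : Tendsto u U (𝓝 u₀) := hu
  exact tendsto_pi_nhds.1 this

lemma closure_form {n₁ n₂ s₁ s₂ : ℕ} (hn : 0 < n₁) (hs₁ : 1 ≤ s₁)
    {X : Matrix (Fin n₁) (Fin n₂) ℂ} (hX : X ∈ closure (diffSet (M1 n₁ n₂ s₁ s₂))) :
    InForm (2 * (s₁ + s₂) - 2) X := by
  classical
  obtain ⟨U, hU, hle⟩ := mem_closure_iff_ultrafilter.1 hX
  have hne : Nonempty (Fin n₁) := ⟨⟨0, hn⟩⟩
  have hXl : ∀ l j, Tendsto (fun Z : Matrix (Fin n₁) (Fin n₂) ℂ => Z l j) U (𝓝 (X l j)) := by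
    intro l j
    have : Continuous (fun Z : Matrix (Fin n₁) (Fin n₂) ℂ => Z l j) := by fun_prop
    exact (this.tendsto X).mono_left hle
  have hdata : ∀ Z : Matrix (Fin n₁) (Fin n₂) ℂ, ∃ (d : (Fin n₁ × Fin n₁) ×
      (Finset (Fin n₁) × Finset (Fin n₁)) × (Finset (Fin n₂) × Finset (Fin n₂)))
      (u w : Fin n₁ → ℂ) (v z : Fin n₂ → ℂ), Z ∈ diffSet (M1 n₁ n₂ s₁ s₂) →
      (d.2.1.1.card ≤ s₁ ∧ d.2.2.1.card ≤ s₂ ∧ d.1.1 ∈ d.2.1.1 ∧ u d.1.1 = 1 ∧ (∀ l, ‖u l‖ ≤ 1) ∧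
        (∀ l, l ∉ d.2.1.1 → u l = 0) ∧ (∀ j, j ∉ d.2.2.1 → v j = 0)) ∧
      (d.2.1.2.card ≤ s₁ ∧ d.2.2.2.card ≤ s₂ ∧ d.1.2 ∈ d.2.1.2 ∧ w d.1.2 = 1 ∧ (∀ l, ‖w l‖ ≤ 1) ∧
        (∀ l, l ∉ d.2.1.2 → w l = 0) ∧ (∀ j, j ∉ d.2.2.2 → z j = 0)) ∧
      ∀ l j, Z l j = u l * v j - w l * z j := by
    intro Z
    by_cases hZ : Z ∈ diffSet (M1 n₁ n₂ s₁ s₂)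
    · obtain ⟨A, hA, B, hB, rfl⟩ := hZ
      obtain ⟨i, S, T, u, v, h1, h2, h3, h4, h5, h6, h7, h8⟩ := norm_M1 hn hs₁ hA
      obtain ⟨k, S', T', w, z, g1, g2, g3, g4, g5, g6, g7, g8⟩ := norm_M1 hn hs₁ hB
      exact ⟨((i, k), (S, S'), (T, T')), u, w, v, z, fun _ => ⟨⟨h1, h2, h3, h4, h5, h6, h7⟩,
        ⟨g1, g2, g3, g4, g5, g6, g7⟩, fun l j => by simp [h8, g8]⟩⟩
    · exact ⟨((⟨0, hn⟩, ⟨0, hn⟩), (∅, ∅), (∅, ∅)), 0, 0, 0, 0, fun h => absurd h hZ⟩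
  choose d u w v z hd using hdata
  obtain ⟨⟨⟨i, k⟩, ⟨S, S'⟩, ⟨T, T'⟩⟩, hc⟩ := ultra_const U d
  have hall : ∀ᶠ Z in (U : Filter (Matrix (Fin n₁) (Fin n₂) ℂ)),
      (S.card ≤ s₁ ∧ T.card ≤ s₂ ∧ i ∈ S ∧ u Z i = 1 ∧ (∀ l, ‖u Z l‖ ≤ 1) ∧
        (∀ l, l ∉ S → u Z l = 0) ∧ (∀ j, j ∉ T → v Z j = 0)) ∧
      (S'.card ≤ s₁ ∧ T'.card ≤ s₂ ∧ k ∈ S' ∧ w Z k = 1 ∧ (∀ l, ‖w Z l‖ ≤ 1) ∧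
        (∀ l, l ∉ S' → w Z l = 0) ∧ (∀ j, j ∉ T' → z Z j = 0)) ∧
      ∀ l j, Z l j = u Z l * v Z j - w Z l * z Z j := by
    filter_upwards [hc, (show ∀ᶠ Z in (U : Filter (Matrix (Fin n₁) (Fin n₂) ℂ)),
      Z ∈ diffSet (M1 n₁ n₂ s₁ s₂) from hU)] with Z h1 h2
    have := hd Z h2
    rw [h1] at this
    exact this
  clear hd hc d
  obtain ⟨_, ⟨hS, hT, hiS, -⟩, ⟨hS', hT', hkS', -⟩, -⟩ := hall.exists
  have hui := hall.mono fun Z h => h.1.2.2.2.1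
  have hub := hall.mono fun Z h => h.1.2.2.2.2.1
  have huS := hall.mono fun Z h => h.1.2.2.2.2.2.1
  have hvT := hall.mono fun Z h => h.1.2.2.2.2.2.2
  have hwk := hall.mono fun Z h => h.2.1.2.2.2.1
  have hwb := hall.mono fun Z h => h.2.1.2.2.2.2.1
  have hwS := hall.mono fun Z h => h.2.1.2.2.2.2.2.1
  have hzT := hall.mono fun Z h => h.2.1.2.2.2.2.2.2
  have hZ := hall.mono fun Z h => h.2.2
  clear hall
  obtain ⟨u₀, hu₀⟩ := ultra_lim U u hub
  obtain ⟨w₀, hw₀⟩ := ultra_lim U w hwb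
  have hlim0 : ∀ {f : Matrix (Fin n₁) (Fin n₂) ℂ → ℂ} {a c : ℂ}, Tendsto f U (𝓝 a) →
      (∀ᶠ Z in (U : Filter (Matrix (Fin n₁) (Fin n₂) ℂ)), f Z = c) → a = c := by
    intro f a c h1 h2
    exact tendsto_nhds_unique h1 ((tendsto_congr' h2).2 tendsto_const_nhds)
  have hu₀i : u₀ i = 1 := hlim0 (hu₀ i) hui
  have hw₀k : w₀ k = 1 := hlim0 (hw₀ k) hwk
  have hu₀S : ∀ l, l ∉ S → u₀ l = 0 := fun l hl => hlim0 (hu₀ l) (huS.mono fun Z h => h l hl)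
  have hw₀S : ∀ l, l ∉ S' → w₀ l = 0 := fun l hl => hlim0 (hw₀ l) (hwS.mono fun Z h => h l hl)
  by_cases hD : ∃ l l', u₀ l * w₀ l' - u₀ l' * w₀ l ≠ 0
  · obtain ⟨l, l', hD⟩ := hD
    have hDt : Tendsto (fun Z => u Z l * w Z l' - u Z l' * w Z l) U
      (𝓝 (u₀ l * w₀ l' - u₀ l' * w₀ l)) :=
      ((hu₀ l).mul (hw₀ l')).sub ((hu₀ l').mul (hw₀ l))
    have hDe := hDt.eventually_ne hD
    have hv : ∀ j, Tendsto (fun Z => v Z j) U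
        (𝓝 ((w₀ l' * X l j - w₀ l * X l' j) / (u₀ l * w₀ l' - u₀ l' * w₀ l))) := by
      intro j
      refine Tendsto.congr' ?_
        ((((hw₀ l').mul (hXl l j)).sub ((hw₀ l).mul (hXl l' j))).div hDt hD)
      filter_upwards [hDe, hZ] with Z h1 h2
      simp only [Pi.div_apply]
      rw [div_eq_iff h1, h2 l j, h2 l' j]; ring
    have hz : ∀ j, Tendsto (fun Z => z Z j) U
        (𝓝 ((u₀ l' * X l j - u₀ l * X l' j) / (u₀ l * w₀ l' - u₀ l' * w₀ l))) := by
      intro j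
      refine Tendsto.congr' ?_
        ((((hu₀ l').mul (hXl l j)).sub ((hu₀ l).mul (hXl l' j))).div hDt hD)
      filter_upwards [hDe, hZ] with Z h1 h2
      simp only [Pi.div_apply]
      rw [div_eq_iff h1, h2 l j, h2 l' j]; ring
    generalize hv0 : (fun j => (w₀ l' * X l j - w₀ l * X l' j) / (u₀ l * w₀ l' - u₀ l' * w₀ l)) = v₀
    generalize hz0 : (fun j => (u₀ l' * X l j - u₀ l * X l' j) / (u₀ l * w₀ l' - u₀ l' * w₀ l)) = z₀
    replace hv : ∀ j, Tendsto (fun Z => v Z j) U (𝓝 (v₀ j)) := by rw [← hv0]; exact hv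
    replace hz : ∀ j, Tendsto (fun Z => z Z j) U (𝓝 (z₀ j)) := by rw [← hz0]; exact hz
    refine ⟨i, k, true, S.erase i, S'.erase k, T, T', u₀, w₀, v₀, fun j => - z₀ j, ?_, hu₀i,
      ?_, ?_, ?_, ?_, ?_⟩
    · rw [Finset.card_erase_of_mem hiS, Finset.card_erase_of_mem hkS']
      omega
    · intro l hl
      by_cases h : l = i
      · subst h; simp [hu₀i]
      · simp only [h, Pi.single_eq_of_ne, ne_eq, not_false_eq_true]
        exact hu₀S l (by simpa [h] using hl)
    · intro l hl
      by_cases h : l = k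
      · subst h; simp [hw₀k]
      · simp only [h, Pi.single_eq_of_ne, ne_eq, not_false_eq_true]
        exact hw₀S l (by simpa [h] using hl)
    · intro j hj; exact hlim0 (hv j) (hvT.mono fun Z h => h j hj)
    · intro j hj
      have := hlim0 (hz j) (hzT.mono fun Z h => h j hj)
      simp [this]
    · intro l j
      have h1 := ((hu₀ l).mul (hv j)).sub ((hw₀ l).mul (hz j))
      have h2 := tendsto_nhds_unique ((tendsto_congr' (hZ.mono fun Z h => h l j)).1 (hXl l j)) h1
      rw [h2]; ring
  · push Not at hD
    have hwu : ∀ l, w₀ l = u₀ l * w₀ i := by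
      intro l; have := hD i l; rw [hu₀i] at this; linear_combination this
    have hwi : w₀ i ≠ 0 := by
      intro h; have := hwu k; rw [hw₀k, h] at this; simp at this
    have hwie := (hw₀ i).eventually_ne hwi
    have hw' : ∀ l, Tendsto (fun Z => w Z l / w Z i) U (𝓝 (u₀ l)) := by
      intro l
      have := (hw₀ l).div (hw₀ i) hwi
      rwa [hwu l, mul_div_cancel_right₀ _ hwi] at this
    have hrow : ∀ᶠ Z in (U : Filter (Matrix (Fin n₁) (Fin n₂) ℂ)),
        ∀ j, Z i j = v Z j - z Z j * w Z i := by
      filter_upwards [hZ, hui] with Z h1 h2 j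
      rw [h1 i j, h2]; ring
    have hAt : ∀ l j, Tendsto (fun Z => (u Z l - w Z l / w Z i) * (z Z j * w Z i)) U
        (𝓝 (X l j - u₀ l * X i j)) := by
      intro l j
      refine Tendsto.congr' ?_ ((hXl l j).sub ((hu₀ l).mul (hXl i j)))
      filter_upwards [hZ, hrow, hwie] with Z h1 h2 h3
      rw [h2 j, h1 l j]; field_simp; ring
    generalize hA0 : (fun l j => X l j - u₀ l * X i j) = A
    have hAX : ∀ l j, X l j - u₀ l * X i j = A l j := by intro l j; rw [← hA0]
    simp only [hAX] at hAt
    have hrank : ∀ l l' j j', A l j * A l' j' = A l j' * A l' j := by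
      intro l l' j j'
      refine tendsto_nhds_unique ((hAt l j).mul (hAt l' j')) ?_
      refine Tendsto.congr ?_ ((hAt l j').mul (hAt l' j))
      intro Z; ring
    have hAi : ∀ j, A i j = 0 := by
      intro j; rw [← hAX, hu₀i]; ring
    have hu₀S' : ∀ l, l ∉ S' → u₀ l = 0 := by
      intro l hl
      refine hlim0 (hw' l) (hwS.mono fun Z h => ?_)
      simp [h l hl]
    have hAS : ∀ l j, l ∉ S ∪ S' → A l j = 0 := by
      intro l j hl
      simp only [Finset.mem_union, not_or] at hl
      refine hlim0 (hAt l j) ?_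
      filter_upwards [huS, hwS] with Z h1 h2
      simp [h1 l hl.1, h2 l hl.2]
    have hAT : ∀ l j, j ∉ T ∩ T' → A l j = 0 := by
      intro l j hj
      by_cases h : j ∈ T'
      · have hjT : j ∉ T := fun h' => hj (Finset.mem_inter.2 ⟨h', h⟩)
        have h1 := ((hu₀ l).sub (hw' l)).mul (hXl i j).neg
        rw [sub_self, zero_mul] at h1
        refine tendsto_nhds_unique (hAt l j) (Tendsto.congr' ?_ h1)
        filter_upwards [hrow, hvT] with Z h2 h3
        rw [h2 j, h3 j hjT]; ring
      · refine hlim0 (hAt l j) (hzT.mono fun Z h' => ?_)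
        simp [h' j h]
    have hXT : ∀ j, j ∉ T ∪ T' → X i j = 0 := by
      intro j hj
      simp only [Finset.mem_union, not_or] at hj
      refine hlim0 (hXl i j) ?_
      filter_upwards [hrow, hvT, hzT] with Z h1 h2 h3
      rw [h1 j, h2 j hj.1, h3 j hj.2]; ring
    have hiS' : i ∈ S' := by
      by_contra h
      have := hu₀S' i h
      rw [hu₀i] at this; exact one_ne_zero this
    obtain ⟨a, q, haq, hai, haS, hqT⟩ : ∃ (a : Fin n₁ → ℂ) (q : Fin n₂ → ℂ),
        (∀ l j, A l j = a l * q j) ∧ a i = 0 ∧ (∀ l, l ∉ S ∪ S' → a l = 0) ∧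
        (∀ j, j ∉ T ∩ T' → q j = 0) := by
      by_cases h : ∃ l j, A l j ≠ 0
      · obtain ⟨l₀, j₀, h⟩ := h
        refine ⟨fun l => A l j₀, fun j => A l₀ j / A l₀ j₀, ?_, hAi _, fun l hl => hAS l j₀ hl,
          fun j hj => by simp [hAT l₀ j hj]⟩
        intro l j
        field_simp
        exact hrank l l₀ j j₀
      · push Not at h
        exact ⟨0, 0, by simpa using h, rfl, by simp, by simp⟩
    refine ⟨i, i, false, (S ∩ S').erase i, (S ∪ S').erase i, T ∪ T', T ∩ T', u₀, a, X i, q, ?_,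
      hu₀i, ?_, ?_, hXT, hqT, ?_⟩
    · rw [Finset.card_erase_of_mem (Finset.mem_inter.2 ⟨hiS, hiS'⟩),
        Finset.card_erase_of_mem (Finset.mem_union_left _ hiS)]
      have h1 := Finset.card_union_add_card_inter S S'
      have h2 := Finset.card_union_add_card_inter T T'
      have h3 : 0 < (S ∩ S').card := Finset.card_pos.2 ⟨i, Finset.mem_inter.2 ⟨hiS, hiS'⟩⟩
      have h4 : 0 < (S ∪ S').card := Finset.card_pos.2 ⟨i, Finset.mem_union_left _ hiS⟩
      omega
    · intro l hl
      by_cases h : l = i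
      · subst h; simp [hu₀i]
      · simp only [h, Pi.single_eq_of_ne, ne_eq, not_false_eq_true]
        have hl : ¬ (l ∈ S ∧ l ∈ S') := by simpa [h] using hl
        by_cases h' : l ∈ S
        · exact hu₀S' l fun h'' => hl ⟨h', h''⟩
        · exact hu₀S l h'
    · intro l hl
      by_cases h : l = i
      · subst h; simp [hai]
      · simp only [h, Pi.single_eq_of_ne, ne_eq, not_false_eq_true]
        exact haS l fun h' => hl (Finset.mem_erase.2 ⟨h, h'⟩)
    · intro l j
      rw [← haq, ← hAX]; ring

lemma frob_smul {a b : ℕ} (r : ℝ) (hr : 0 ≤ r) (X : Matrix (Fin a) (Fin b) ℂ) :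
    frob ((r : ℂ) • X) = r * frob X := by
  unfold frob
  rw [show (r * √(∑ i, ∑ j, ‖X i j‖ ^ 2)) = √(r ^ 2 * ∑ i, ∑ j, ‖X i j‖ ^ 2) by
    rw [Real.sqrt_mul (by positivity), Real.sqrt_sq hr]]
  congr 1
  simp [Finset.mul_sum, mul_pow]

lemma l2_smul {m : ℕ} (r : ℝ) (hr : 0 ≤ r) (x : Fin m → ℂ) :
    l2 ((r : ℂ) • x) = r * l2 x := by
  unfold l2
  rw [show (r * √(∑ i, ‖x i‖ ^ 2)) = √(r ^ 2 * ∑ i, ‖x i‖ ^ 2) by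
    rw [Real.sqrt_mul (by positivity), Real.sqrt_sq hr]]
  congr 1
  simp [Finset.mul_sum, mul_pow]

lemma sparse_smul {n s : ℕ} (r : ℂ) (u : Fin n → ℂ) (h : Sparse s u) : Sparse s (r • u) := by
  unfold Sparse at *
  refine le_trans (Set.ncard_le_ncard ?_ (Set.toFinite _)) h
  intro i hi
  simp at hi ⊢
  exact hi.2

lemma diff_smul {n₁ n₂ s₁ s₂ : ℕ} (r : ℂ) {X : Matrix (Fin n₁) (Fin n₂) ℂ}
    (h : X ∈ diffSet (M1 n₁ n₂ s₁ s₂)) : r • X ∈ diffSet (M1 n₁ n₂ s₁ s₂) := by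
  obtain ⟨A, ⟨u, v, hu, hv, rfl⟩, B, ⟨w, z, hw, hz, rfl⟩, rfl⟩ := h
  refine ⟨_, ⟨r • u, v, sparse_smul r u hu, hv, rfl⟩, _, ⟨r • w, z, sparse_smul r w hw, hz, rfl⟩, ?_⟩
  rw [Matrix.smul_vecMulVec, Matrix.smul_vecMulVec, smul_sub]

lemma stable {n₁ n₂ s₁ s₂ m : ℕ} (Y : Fin m → Fin n₂ → Fin n₁ → ℂ)
    (hY : ∀ X ∈ closure (diffSet (M1 n₁ n₂ s₁ s₂)), X ≠ 0 →
      ¬ ∀ k, Matrix.trace (Matrix.of (Y k) * X) = 0) :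
    StablyInj n₁ n₂ s₁ s₂ m (fun X i => Matrix.trace (Matrix.of (Y i) * X)) := by
  set M : Matrix (Fin n₁) (Fin n₂) ℂ → Fin m → ℂ :=
    fun X i => Matrix.trace (Matrix.of (Y i) * X) with hM
  have hfc : Continuous (fun X : Matrix (Fin n₁) (Fin n₂) ℂ => frob X) := by
    unfold frob; fun_prop
  have hlc : Continuous (fun X : Matrix (Fin n₁) (Fin n₂) ℂ => l2 (M X)) := by
    unfold l2; simp only [hM, Matrix.trace, Matrix.diag, Matrix.mul_apply]; fun_prop
  let K := closure (diffSet (M1 n₁ n₂ s₁ s₂)) ∩ {X | frob X = 1}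
  have hK : IsCompact K := by
    have hbox : IsCompact (Set.pi Set.univ fun _ : Fin n₁ => Set.pi Set.univ fun _ : Fin n₂ =>
        Metric.closedBall (0 : ℂ) 1) :=
      isCompact_univ_pi fun _ => isCompact_univ_pi fun _ => isCompact_closedBall (0:ℂ) 1
    refine hbox.of_isClosed_subset (isClosed_closure.inter (isClosed_eq hfc continuous_const)) ?_
    rintro X ⟨-, hX⟩ i - j -
    rw [mem_closedBall_zero_iff]
    have hX : frob X = 1 := hX
    unfold frob at hX
    rw [Real.sqrt_eq_one] at hX
    have h1 : ‖X i j‖ ^ 2 ≤ ∑ j, ‖X i j‖ ^ 2 :=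
      Finset.single_le_sum (f := fun j => ‖X i j‖ ^ 2) (fun _ _ => by positivity) (Finset.mem_univ j)
    have h2 : ∑ j, ‖X i j‖ ^ 2 ≤ ∑ i, ∑ j, ‖X i j‖ ^ 2 :=
      Finset.single_le_sum (f := fun i => ∑ j, ‖X i j‖ ^ 2) (fun _ _ => by positivity)
        (Finset.mem_univ i)
    have h3 : ‖X i j‖ ^ 2 ≤ 1 := by linarith
    exact (sq_le_one_iff₀ (norm_nonneg _)).1 h3
  have hfn : ∀ X : Matrix (Fin n₁) (Fin n₂) ℂ, 0 ≤ frob X := fun X => Real.sqrt_nonneg _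
  have hscale : ∀ X ∈ diffSet (M1 n₁ n₂ s₁ s₂), frob X ≠ 0 →
      (((frob X)⁻¹ : ℝ) : ℂ) • X ∈ K ∧ l2 (M ((((frob X)⁻¹ : ℝ) : ℂ) • X)) = (frob X)⁻¹ * l2 (M X) := by
    intro X hX h0
    refine ⟨⟨subset_closure (diff_smul _ hX), ?_⟩, ?_⟩
    · change frob _ = 1
      rw [frob_smul _ (inv_nonneg.2 (hfn X)), inv_mul_cancel₀ h0]
    · rw [← l2_smul _ (inv_nonneg.2 (hfn X))]
      congr 1
      funext i
      simp [hM]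
  rcases K.eq_empty_or_nonempty with hE | hne
  · refine ⟨1, one_pos, fun X hX => ?_⟩
    by_cases h0 : frob X = 0
    · rw [h0]; simp [l2]
    · have := (hscale X hX h0).1
      rw [hE] at this; exact this.elim
  · obtain ⟨X₀, hX₀, hmin⟩ := hK.exists_isMinOn hne hlc.continuousOn
    refine ⟨l2 (M X₀), ?_, fun X hX => ?_⟩
    · have hX1 : frob X₀ = 1 := hX₀.2
      have hne0 : X₀ ≠ 0 := by
        rintro rfl; simp [frob] at hX1
      have := hY X₀ hX₀.1 hne0
      push Not at this
      obtain ⟨k, hk⟩ := this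
      unfold l2
      apply Real.sqrt_pos.2
      refine Finset.sum_pos' (fun _ _ => by positivity) ⟨k, Finset.mem_univ k, ?_⟩
      have : 0 < ‖M X₀ k‖ := norm_pos_iff.2 hk
      positivity
    · by_cases h0 : frob X = 0
      · rw [h0, mul_zero]; exact Real.sqrt_nonneg _
      · obtain ⟨h1, h2⟩ := hscale X hX h0
        have h3 : l2 (M X₀) ≤ l2 (M ((((frob X)⁻¹ : ℝ) : ℂ) • X)) := hmin h1
        rw [h2] at h3
        have hpos : 0 < frob X := lt_of_le_of_ne (hfn X) (Ne.symm h0)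
        rwa [inv_mul_eq_div, le_div_iff₀ hpos] at h3

theorem stmt1 (n₁ n₂ s₁ s₂ m : ℕ) (hn₁ : 2 ≤ n₁) (hn₂ : 2 ≤ n₂)
    (hs₁ : 1 ≤ s₁) (hs₁n : s₁ ≤ n₁) (hs₂ : 1 ≤ s₂) (hs₂n : s₂ ≤ n₂)
    (hm : if s₁ = n₁ ∧ s₂ = n₂ then 2 * (n₁ + n₂) - 4 ≤ m else 2 * (s₁ + s₂) - 2 ≤ m) :
    ∀ᵐ Y ∂(volume : Measure (Fin m → Fin n₂ → Fin n₁ → ℂ)),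
      StablyInj n₁ n₂ s₁ s₂ m
        (fun X i => Matrix.trace (Matrix.of (Y i) * X)) := by
  have hmono : ∀ {N N' : ℕ} {X : Matrix (Fin n₁) (Fin n₂) ℂ}, N ≤ N' → InForm N X → InForm N' X := by
    rintro N N' X hN ⟨i, k, c, P, P', Q, Q', p, a, b, q, h, h'⟩
    exact ⟨i, k, c, P, P', Q, Q', p, a, b, q, h.trans hN, h'⟩
  filter_upwards [ae_form (n₁ := n₁) (n₂ := n₂) (m := m)] with Y hY
  refine stable Y fun X hX => hY X ?_
  have hf := closure_form (by omega) hs₁ hX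
  split_ifs at hm with h
  · exact hmono hm (full_form hn₁ hf)
  · exact hmono hm hf
end
end

section
/- Let k,l ≥ 1 be such that 2(k+l)−4 ≤ m. Then for Lebesgue-almost every pair of matrices (E,D) ∈ M(m,k) × M(m,l), the set (ran E ∖ {0}) × (ran D ∖ {0}) is strongly identifiable modulo scaling with respect to the circular convolution map C : ℂ^m × ℂ^m → ℂ^m, C(v,w) = v ⊛ w. (The paper phrases this for Haar-almost all pairs of subspaces of dimensions k and l in the product of Grassmannians; this Lebesgue-measure formulation for the spanning matrices is the statement from which the Grassmannian version is obtained by pushing the measure forward.) -/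
noncomputable section

open MeasureTheory Matrix

/-- The circular convolution: `(v ⊛ w)ᵢ = Σⱼ vⱼ w_{((i−j−1) mod m)+1}` (1-based indexing),
written here with 0-based indices, the entry index `(i−j−1) mod m` being computed in `ℕ`
as `(m + i - j - 1) % m`. -/
def circConv (m : ℕ) (v w : Fin m → ℂ) : Fin m → ℂ :=
  fun i => ∑ j : Fin m, v j * w ⟨(m + i.val - j.val - 1) % m, Nat.mod_lt _ i.pos⟩

/-- A subset `V ⊆ (ℂ^{n₁}∖{0}) × (ℂ^{n₂}∖{0})` is strongly identifiable modulo scaling with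
respect to a (bilinear) map `B` if `B(u,v) = B(u′,v′)` for `(u,v),(u′,v′) ∈ V` implies that
there is `λ ≠ 0` with `u = λu′` and `v = (1/λ)v′`. -/
def StrongIdent {n₁ n₂ m : ℕ} (V : Set ((Fin n₁ → ℂ) × (Fin n₂ → ℂ)))
    (B : (Fin n₁ → ℂ) → (Fin n₂ → ℂ) → (Fin m → ℂ)) : Prop :=
  ∀ p ∈ V, ∀ q ∈ V, B p.1 p.2 = B q.1 q.2 →
    ∃ l : ℂ, l ≠ 0 ∧ p.1 = l • q.1 ∧ p.2 = l⁻¹ • q.2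

lemma lemA (k l m : ℕ) (hm : 1 ≤ m) (h : 2 * (k + l) - 4 ≤ m)
    (a a' : Fin k → ℂ) (b b' : Fin l → ℂ) (Y : Fin k → Fin l → ℂ)
    (hY : ∀ i j, Y i j = a i * b j - a' i * b' j) (p : Fin k) (q : Fin l) (hpq : Y p q = 1) :
    ∃ S : Finset ℂ, S.card < m ∧ ∀ L : Subfield ℂ, (∀ s ∈ S, s ∈ L) → ∀ i j, Y i j ∈ L := by
  have hk := p.pos
  have hl := q.pos
  by_cases hr : ∀ i j, Y i j = Y i q * Y p j
  · refine ⟨(Finset.univ.erase q).image (fun j => Y p j) ∪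
      (Finset.univ.erase p).image (fun i => Y i q), ?_, ?_⟩
    · refine (Finset.card_union_le _ _).trans_lt ?_
      have h1 := Finset.card_image_le (s := Finset.univ.erase q) (f := fun j => Y p j)
      have h2 := Finset.card_image_le (s := Finset.univ.erase p) (f := fun i => Y i q)
      simp only [Finset.card_erase_of_mem (Finset.mem_univ _), Finset.card_univ, Fintype.card_fin] at h1 h2
      omega
    · intro L hL
      have c1 : ∀ j, Y p j ∈ L := by
        intro j
        by_cases hj : j = q
        · subst hj; rw [hpq]; exact L.one_mem
        · apply hL; simp only [Finset.mem_union, Finset.mem_image, Finset.mem_erase]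
          exact Or.inl ⟨j, by simp [hj], rfl⟩
      have c2 : ∀ j, Y j q ∈ L := by
        intro j
        by_cases hj : j = p
        · subst hj; rw [hpq]; exact L.one_mem
        · apply hL; simp only [Finset.mem_union, Finset.mem_image, Finset.mem_erase]
          exact Or.inr ⟨j, by simp [hj], rfl⟩
      intro i j
      rw [hr i j]
      exact L.mul_mem (c2 i) (c1 j)
  · push Not at hr
    obtain ⟨p2, q2, hne⟩ := hr
    have hp : p2 ≠ p := by
      rintro rfl; apply hne; rw [hpq, one_mul]
    have hq : q2 ≠ q := by
      rintro rfl; apply hne; rw [hpq, mul_one]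
    have hD : Y p2 q2 - Y p2 q * Y p q2 ≠ 0 := sub_ne_zero.mpr hne
    have key : ∀ i j, Y i j = (Y p2 j * Y i q2 - Y p q2 * Y p2 j * Y i q
        - Y p j * (Y p2 q * Y i q2 - Y p2 q2 * Y i q)) / (Y p2 q2 - Y p2 q * Y p q2) := by
      intro i j
      rw [eq_div_iff hD]
      have : Y p q * (Y p2 q2 * Y i j - Y p2 j * Y i q2) - Y p q2 * (Y p2 q * Y i j - Y p2 j * Y i q)
        + Y p j * (Y p2 q * Y i q2 - Y p2 q2 * Y i q) = 0 := by
        simp only [hY]; ring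
      rw [hpq] at this
      linear_combination this
    refine ⟨((Finset.univ.erase q).image (fun j => Y p j) ∪
      (Finset.univ.erase p).image (fun i => Y i q)) ∪ ((Finset.univ.erase q).image (fun j => Y p2 j) ∪
      ((Finset.univ.erase p).erase p2).image (fun i => Y i q2)), ?_, ?_⟩
    · refine (Finset.card_union_le _ _).trans_lt ?_
      have h0 := Finset.card_union_le ((Finset.univ.erase q).image (fun j => Y p j)) ((Finset.univ.erase p).image (fun i => Y i q))
      have h0' := Finset.card_union_le ((Finset.univ.erase q).image (fun j => Y p2 j)) (((Finset.univ.erase p).erase p2).image (fun i => Y i q2))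
      have h1 := Finset.card_image_le (s := Finset.univ.erase q) (f := fun j => Y p j)
      have h2 := Finset.card_image_le (s := Finset.univ.erase p) (f := fun i => Y i q)
      have h3 := Finset.card_image_le (s := Finset.univ.erase q) (f := fun j => Y p2 j)
      have h4 := Finset.card_image_le (s := (Finset.univ.erase p).erase p2) (f := fun i => Y i q2)
      have hmem : p2 ∈ Finset.univ.erase p := by simp [hp]
      rw [Finset.card_erase_of_mem hmem] at h4
      simp only [Finset.card_erase_of_mem (Finset.mem_univ _), Finset.card_univ, Fintype.card_fin] at h1 h2 h3 h4
      have := p2.isLt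
      have := p.isLt
      have : p2.val ≠ p.val := fun hh => hp (Fin.ext hh)
      have := q2.isLt
      have := q.isLt
      have : q2.val ≠ q.val := fun hh => hq (Fin.ext hh)
      omega
    · intro L hL
      simp only [Finset.mem_union, Finset.mem_image, Finset.mem_erase] at hL
      have c1 : ∀ j, Y p j ∈ L := by
        intro j
        by_cases hj : j = q
        · subst hj; rw [hpq]; exact L.one_mem
        · apply hL
          exact Or.inl (Or.inl ⟨j, by simp [hj], rfl⟩)
      have c2 : ∀ j, Y j q ∈ L := by
        intro j
        by_cases hj : j = p
        · subst hj; rw [hpq]; exact L.one_mem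
        · apply hL
          exact Or.inl (Or.inr ⟨j, by simp [hj], rfl⟩)
      have c3 : ∀ j, Y p2 j ∈ L := by
        intro j
        by_cases hj : j = q
        · subst hj; exact c2 _
        · apply hL
          exact Or.inr (Or.inl ⟨j, by simp [hj], rfl⟩)
      have c4 : ∀ i, Y i q2 ∈ L := by
        intro j
        by_cases hj : j = p
        · subst hj; exact c1 _
        by_cases hj' : j = p2
        · subst hj'; exact c3 _
        · apply hL
          exact Or.inr (Or.inr ⟨j, by simp [hj, hj'], rfl⟩)
      intro i j
      rw [key i j]
      exact L.div_mem (L.sub_mem (L.sub_mem (L.mul_mem (c3 _) (c4 _))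
        (L.mul_mem (L.mul_mem (c1 _) (c3 _)) (c2 _))) (L.mul_mem (c1 _) (L.sub_mem
        (L.mul_mem (c3 _) (c4 _)) (L.mul_mem (c3 _) (c2 _)))))
        (L.sub_mem (c3 _) (L.mul_mem (c3 _) (c1 _)))

lemma lemB (k l : ℕ) (Y : Fin k → Fin l → ℂ) (p : Fin k) (q : Fin l) (hpq : Y p q = 1)
    (e : Fin k → ℂ) (d : Fin l → ℂ) (h0 : ∑ i, e i * ∑ j, Y i j * d j = 0) :
    ∃ S : Finset ℂ, S.card ≤ k + l - 1 ∧ ∀ L : Subfield ℂ, (∀ i j, Y i j ∈ L) →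
      (∀ s ∈ S, s ∈ L) → (∀ i, e i ∈ L) ∧ (∀ j, d j ∈ L) := by
  have hk := p.pos
  have hl := q.pos
  by_cases hz : ∑ j, Y p j * d j = 0
  · refine ⟨(Finset.univ).image e ∪ (Finset.univ.erase q).image d, ?_, ?_⟩
    · refine (Finset.card_union_le _ _).trans ?_
      have h1 := Finset.card_image_le (s := Finset.univ.erase q) (f := d)
      have h2 := Finset.card_image_le (s := Finset.univ) (f := e)
      simp only [Finset.card_erase_of_mem (Finset.mem_univ _), Finset.card_univ, Fintype.card_fin] at h1 h2
      omega
    · intro L hYL hL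
      simp only [Finset.mem_union, Finset.mem_image, Finset.mem_erase] at hL
      refine ⟨fun i => hL _ (Or.inl ⟨i, by simp, rfl⟩), ?_⟩
      have c : ∀ j, j ≠ q → d j ∈ L := fun j hj => hL _ (Or.inr ⟨j, by simp [hj], rfl⟩)
      intro j
      by_cases hj : j = q
      · subst hj
        rw [← Finset.add_sum_erase _ _ (Finset.mem_univ j), hpq, one_mul] at hz
        rw [eq_neg_of_add_eq_zero_left hz]
        refine L.neg_mem (L.sum_mem fun i hi => L.mul_mem (hYL _ _) (c _ (Finset.ne_of_mem_erase hi)))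
      · exact c j hj
  · refine ⟨(Finset.univ.erase p).image e ∪ (Finset.univ).image d, ?_, ?_⟩
    · refine (Finset.card_union_le _ _).trans ?_
      have h1 := Finset.card_image_le (s := Finset.univ.erase p) (f := e)
      have h2 := Finset.card_image_le (s := Finset.univ) (f := d)
      simp only [Finset.card_erase_of_mem (Finset.mem_univ _), Finset.card_univ, Fintype.card_fin] at h1 h2
      omega
    · intro L hYL hL
      simp only [Finset.mem_union, Finset.mem_image, Finset.mem_erase] at hL
      have cd : ∀ i, d i ∈ L := fun i => hL _ (Or.inr ⟨i, by simp, rfl⟩)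
      refine ⟨?_, cd⟩
      have c : ∀ j, j ≠ p → e j ∈ L := fun j hj => hL _ (Or.inl ⟨j, by simp [hj], rfl⟩)
      have cs : ∀ i, ∑ j, Y i j * d j ∈ L := fun i => L.sum_mem fun j _ => L.mul_mem (hYL _ _) (cd _)
      intro j
      by_cases hj : j = p
      · subst hj
        rw [← Finset.add_sum_erase _ _ (Finset.mem_univ j)] at h0
        rw [eq_div_of_mul_eq hz (eq_neg_of_add_eq_zero_left h0)]
        exact L.div_mem (L.neg_mem (L.sum_mem fun i hi => L.mul_mem (c _ (Finset.ne_of_mem_erase hi)) (cs _))) (cs _)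
      · exact c j hj

/-- The algebraic closure of ℚ(S) as a subfield. -/
def algCl (S : Set ℂ) : Subfield ℂ :=
  { (Subalgebra.algebraicClosure (Algebra.adjoin ℚ S) ℂ).toSubring with
    inv_mem' := fun x hx => by
      have hx' : IsAlgebraic (Algebra.adjoin ℚ S) x := hx
      exact hx'.inv }

lemma mem_algCl {S : Set ℂ} {x : ℂ} : x ∈ algCl S ↔ IsAlgebraic (Algebra.adjoin ℚ S) x := Iff.rfl

lemma lemC {ι : Type} [Fintype ι] (x : ι → ℂ) (hx : AlgebraicIndependent ℚ x) (S : Finset ℂ)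
    (h : ∀ i, x i ∈ algCl S) : Fintype.card ι ≤ S.card := by
  let M := AlgebraicIndependent.matroid ℚ ℂ
  have h1 : M.Indep (Set.range x) := by
    rw [AlgebraicIndependent.matroid_indep_iff]
    exact hx.to_subtype_range
  have h2 : Set.range x ⊆ M.closure S := by
    rw [AlgebraicIndependent.matroid_closure_eq]
    rintro _ ⟨i, rfl⟩
    exact h i
  have h3 : (Set.range x).encard ≤ (S : Set ℂ).encard := by
    rw [← h1.eRk_eq_encard]
    refine (M.eRk_mono h2).trans ?_
    rw [M.eRk_closure_eq]
    exact M.eRk_le_encard _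
  rw [← Set.image_univ, hx.injective.encard_image] at h3
  simpa using h3

lemma poly_null : ∀ (n : ℕ) (p : MvPolynomial (Fin n) ℂ), p ≠ 0 →
    ∀ᵐ x : Fin n → ℂ, MvPolynomial.eval x p ≠ 0 := by
  intro n
  induction n with
  | zero =>
    intro p hp
    refine Filter.Eventually.of_forall fun x hx => hp ?_
    rw [MvPolynomial.eq_C_of_isEmpty p] at hx ⊢
    rw [MvPolynomial.eval_C] at hx
    rw [hx, map_zero]
  | succ n ih =>
    intro p hp
    have hq : MvPolynomial.finSuccEquiv ℂ n p ≠ 0 := by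
      simpa using hp
    obtain ⟨i, hi⟩ : ∃ i, (MvPolynomial.finSuccEquiv ℂ n p).coeff i ≠ 0 := by
      by_contra! hc
      exact hq (Polynomial.ext (by simpa using hc))
    have h1 := ih _ hi
    have hmeas : MeasurableSet {z : (Fin n → ℂ) × ℂ |
        MvPolynomial.eval (Fin.cons z.2 z.1 : Fin (n+1) → ℂ) p ≠ 0} := by
      apply IsOpen.measurableSet
      have : Continuous fun z : (Fin n → ℂ) × ℂ =>
        MvPolynomial.eval (Fin.cons z.2 z.1 : Fin (n+1) → ℂ) p := by
        have h := MvPolynomial.continuous_eval p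
        refine h.comp ?_
        fun_prop
      exact isOpen_ne_fun this continuous_const
    have h2 : ∀ᵐ z : (Fin n → ℂ) × ℂ ∂((volume : Measure (Fin n → ℂ)).prod (volume : Measure ℂ)),
        MvPolynomial.eval (Fin.cons z.2 z.1 : Fin (n+1) → ℂ) p ≠ 0 := by
      rw [Measure.ae_prod_iff_ae_ae hmeas]
      filter_upwards [h1] with s hs
      have hne : Polynomial.map (MvPolynomial.eval s) (MvPolynomial.finSuccEquiv ℂ n p) ≠ 0 := by
        intro h0
        apply hs
        rw [← Polynomial.coeff_map, h0, Polynomial.coeff_zero]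
      have hfin : {y : ℂ | Polynomial.IsRoot
          (Polynomial.map (MvPolynomial.eval s) (MvPolynomial.finSuccEquiv ℂ n p)) y}.Finite :=
        Polynomial.finite_setOfPred_isRoot hne
      have := hfin.countable.ae_notMem (volume : Measure ℂ)
      filter_upwards [this] with y hy h0
      apply hy
      rw [MvPolynomial.eval_eq_eval_mv_eval'] at h0
      exact h0
    have mp : MeasurePreserving (fun x : Fin (n+1) → ℂ => ((Fin.tail x : Fin n → ℂ), x 0)) volume
        ((volume : Measure (Fin n → ℂ)).prod (volume : Measure ℂ)) := by
      have := (volume_preserving_piFinSuccAbove (fun _ : Fin (n+1) => ℂ) 0)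
      exact Measure.measurePreserving_swap.comp this
    have h3 := mp.quasiMeasurePreserving.ae h2
    filter_upwards [h3] with x hx
    simpa using hx

lemma ae_algInd (n : ℕ) : ∀ᵐ x : Fin n → ℂ, AlgebraicIndependent ℚ x := by
  have : ∀ᵐ x : Fin n → ℂ, ∀ p : {p : MvPolynomial (Fin n) ℚ // p ≠ 0}, 
      MvPolynomial.eval x (MvPolynomial.map (algebraMap ℚ ℂ) p.1) ≠ 0 := by
    have : Countable (MvPolynomial (Fin n) ℚ) := by
      rw [← Cardinal.mk_le_aleph0_iff]
      refine MvPolynomial.cardinalMk_le_max.trans ?_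
      simp
    rw [ae_all_iff]
    rintro ⟨p, hp⟩
    apply poly_null
    intro h0
    exact hp (MvPolynomial.map_injective _ (algebraMap ℚ ℂ).injective (by simpa using h0))
  filter_upwards [this] with x hx
  rw [algebraicIndependent_iff]
  intro p hp
  by_contra hne
  apply hx ⟨p, hne⟩
  rw [MvPolynomial.eval_map, ← MvPolynomial.aeval_def, hp]

lemma ae_transfer {V : Type*} [NormedAddCommGroup V] [NormedSpace ℝ V] [MeasurableSpace V]
    [BorelSpace V] [FiniteDimensional ℝ V] (μ : Measure V) [μ.IsAddHaarMeasure] {n : ℕ}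
    (e : V ≃ₗ[ℝ] (Fin n → ℂ)) : ∀ᵐ v ∂μ, AlgebraicIndependent ℚ (e v) := by
  let e' := e.toContinuousLinearEquiv
  have h1 : (μ.map e').IsAddHaarMeasure := e'.isAddHaarMeasure_map μ
  have h2 : (μ.map e') ≪ volume := by
    exact Measure.absolutelyContinuous_isAddHaarMeasure _ _
  have h3 := h2.ae_le (ae_algInd n)
  exact ae_of_ae_map e'.continuous.aemeasurable h3

lemma ae_final (m k l : ℕ) :
    ∀ᵐ ED ∂(volume : Measure ((Fin m → Fin k → ℂ) × (Fin m → Fin l → ℂ))),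
      AlgebraicIndependent ℚ (fun z : Fin m × (Fin k ⊕ Fin l) => Sum.elim (ED.1 z.1) (ED.2 z.1) z.2) := by
  let e1 : ((Fin m → Fin k → ℂ) × (Fin m → Fin l → ℂ)) ≃ₗ[ℝ] (Fin m × (Fin k ⊕ Fin l) → ℂ) :=
    { toFun := fun ED z => Sum.elim (ED.1 z.1) (ED.2 z.1) z.2
      invFun := fun f => (fun i j => f (i, Sum.inl j), fun i j => f (i, Sum.inr j))
      left_inv := fun ED => rfl
      right_inv := fun f => by
        ext ⟨i, j | j⟩ <;> rfl
      map_add' := fun x y => by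
        ext ⟨i, j | j⟩ <;> rfl
      map_smul' := fun c y => by
        ext ⟨i, j | j⟩ <;> rfl }
  let g := Fintype.equivFin (Fin m × (Fin k ⊕ Fin l))
  let e := e1.trans (LinearEquiv.funCongrLeft ℝ ℂ g.symm)
  have i1 : (volume : Measure (Fin m → Fin k → ℂ)).IsAddHaarMeasure :=
    Measure.pi.isAddHaarMeasure (fun _ => volume)
  have i2 : (volume : Measure (Fin m → Fin l → ℂ)).IsAddHaarMeasure :=
    Measure.pi.isAddHaarMeasure (fun _ => volume)
  have i3 : (volume : Measure ((Fin m → Fin k → ℂ) × (Fin m → Fin l → ℂ))).IsAddHaarMeasure :=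
    Measure.prod.instIsAddHaarMeasure volume volume
  have := ae_transfer (volume : Measure ((Fin m → Fin k → ℂ) × (Fin m → Fin l → ℂ))) e
  filter_upwards [this] with ED h
  exact (algebraicIndependent_equiv' g.symm rfl).mp h

lemma dft_conv (m : ℕ) (z : ℂ) (hz : z ^ m = 1) (v w : Fin m → ℂ) :
    ∑ i : Fin m, z ^ (i : ℕ) * circConv m v w i =
      z * (∑ j : Fin m, z ^ (j : ℕ) * v j) * (∑ j : Fin m, z ^ (j : ℕ) * w j) := by
  have hmod : ∀ t : ℕ, z ^ (t % m) = z ^ t := fun t => by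
    conv_rhs => rw [← Nat.div_add_mod t m, pow_add, pow_mul, hz, one_pow, one_mul]
  unfold circConv
  simp only [Finset.mul_sum, Finset.sum_mul]
  rw [Finset.sum_comm, Finset.sum_comm (s := Finset.univ) (t := Finset.univ)
    (f := fun (x : Fin m) (i : Fin m) => z * (z ^ (i:ℕ) * v i) * (z ^ (x:ℕ) * w x))]
  refine Finset.sum_congr rfl fun j _ => ?_
  have hinj : Function.Injective (fun i : Fin m =>
      (⟨(m + i.val - j.val - 1) % m, Nat.mod_lt _ i.pos⟩ : Fin m)) := by
    intro a b hab
    simp only [Fin.mk.injEq] at hab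
    have ha := a.isLt
    have hb := b.isLt
    have hj := j.isLt
    have h2 : (m + a.val - j.val - 1) ≡ (m + b.val - j.val - 1) [MOD m] := hab
    have h3 := Nat.ModEq.add_right (j.val + 1) h2
    rw [show m + a.val - j.val - 1 + (j.val + 1) = m + a.val by omega,
      show m + b.val - j.val - 1 + (j.val + 1) = m + b.val by omega] at h3
    unfold Nat.ModEq at h3
    rw [Nat.add_mod_left, Nat.add_mod_left, Nat.mod_eq_of_lt ha, Nat.mod_eq_of_lt hb] at h3
    exact Fin.ext h3
  refine (Finset.sum_congr rfl fun i _ => ?_).trans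
    (Function.Bijective.sum_comp (Finite.injective_iff_bijective.mp hinj)
      (fun x : Fin m => z * (z ^ (j:ℕ) * v j) * (z ^ (x:ℕ) * w x)))
  have hj := j.isLt
  have : z ^ (i:ℕ) = z * z ^ (j:ℕ) * z ^ ((m + i.val - j.val - 1) % m) := by
    rw [hmod, ← pow_succ', ← pow_add, show j.val + 1 + (m + i.val - j.val - 1) = m + i.val by omega,
      pow_add, hz, one_mul]
  simp only
  rw [this]; ring

/-- inversion -/
lemma dft_inv (m : ℕ) (hm : 1 ≤ m) (ζ : ℂ) (hζ : IsPrimitiveRoot ζ m) (v : Fin m → ℂ) (L : Subfield ℂ)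
    (hL : ζ ∈ L) (h : ∀ r : Fin m, ∑ j : Fin m, (ζ ^ (r : ℕ)) ^ (j : ℕ) * v j ∈ L) (j : Fin m) :
    v j ∈ L := by
  have hm0 : (m : ℂ) ≠ 0 := by exact_mod_cast (by omega : m ≠ 0)
  have key : (m : ℂ) * v j = ∑ r : Fin m, (ζ⁻¹ ^ (r:ℕ)) ^ (j:ℕ) *
      ∑ i : Fin m, (ζ ^ (r : ℕ)) ^ (i : ℕ) * v i := by
    have hζ0 : ζ ≠ 0 := hζ.ne_zero (by omega)
    simp only [Finset.mul_sum]
    rw [Finset.sum_comm, Finset.sum_eq_single j]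
    · have : ∀ r : Fin m, (ζ⁻¹ ^ (r:ℕ)) ^ (j:ℕ) * ((ζ ^ (r : ℕ)) ^ (j : ℕ) * v j) = v j := by
        intro r
        rw [← mul_assoc, ← mul_pow, ← mul_pow, inv_mul_cancel₀ hζ0]; simp
      rw [Finset.sum_congr rfl fun r _ => this r]; simp
    · intro i _ hij
      let w := ζ ^ (i:ℕ) * ζ⁻¹ ^ (j:ℕ)
      have hw : w ≠ 1 := by
        intro hw
        have : ζ ^ (i:ℕ) = ζ ^ (j:ℕ) := by
          have h2 := congrArg (· * ζ ^ (j:ℕ)) hw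
          simp only [w, mul_assoc, ← mul_pow, inv_mul_cancel₀ hζ0, one_pow, mul_one, one_mul] at h2
          exact h2
        exact hij (Fin.ext (hζ.pow_inj i.isLt j.isLt this))
      have hwm : w ^ m = 1 := by
        simp only [w, mul_pow, ← pow_mul]
        rw [mul_comm (i:ℕ), mul_comm (j:ℕ), pow_mul, pow_mul, inv_pow, hζ.pow_eq_one]; simp
      have hs : ∑ r : Fin m, w ^ (r:ℕ) = 0 := by
        rw [Fin.sum_univ_eq_sum_range (fun r => w ^ r)]
        have := mul_geom_sum w m
        rw [hwm, sub_self] at this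
        exact (mul_eq_zero.mp this).resolve_left (sub_ne_zero.mpr hw)
      rw [show (0:ℂ) = (∑ r : Fin m, w ^ (r:ℕ)) * v i by rw [hs, zero_mul], Finset.sum_mul]
      refine Finset.sum_congr rfl fun r _ => ?_
      simp only [w, mul_pow, ← pow_mul]
      rw [mul_comm (i:ℕ), mul_comm (j:ℕ)]; ring
    · simp
  rw [eq_div_of_mul_eq hm0 ((mul_comm _ _).trans key)]
  refine L.div_mem (L.sum_mem fun r _ => L.mul_mem (L.pow_mem (L.pow_mem (L.inv_mem hL) _) _) (h r)) ?_
  exact natCast_mem L m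

lemma scale_of_outer {k l : ℕ} (a a' : Fin k → ℂ) (b b' : Fin l → ℂ) (ha : a ≠ 0) (hb : b ≠ 0)
    (h : ∀ i j, a i * b j = a' i * b' j) : ∃ c : ℂ, c ≠ 0 ∧ a = c • a' ∧ b = c⁻¹ • b' := by
  obtain ⟨i0, hi⟩ := Function.ne_iff.mp ha
  obtain ⟨j0, hj⟩ := Function.ne_iff.mp hb
  simp only [Pi.zero_apply] at hi hj
  have h0 : a' i0 * b' j0 ≠ 0 := by rw [← h]; exact mul_ne_zero hi hj
  have hi' := left_ne_zero_of_mul h0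
  have hj' := right_ne_zero_of_mul h0
  refine ⟨a i0 / a' i0, div_ne_zero hi hi', ?_, ?_⟩
  · ext i
    simp only [Pi.smul_apply, smul_eq_mul]
    rw [div_mul_eq_mul_div, eq_div_iff hi']
    apply mul_right_cancel₀ hj
    linear_combination a' i0 * h i j0 - a' i * h i0 j0
  · ext j
    simp only [Pi.smul_apply, smul_eq_mul, inv_div]
    rw [div_mul_eq_mul_div, eq_div_iff hi]
    linear_combination h i0 j

lemma core_s3 (m k l : ℕ) (hm : 1 ≤ m) (h : 2 * (k + l) - 4 ≤ m)
    (E : Fin m → Fin k → ℂ) (D : Fin m → Fin l → ℂ)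
    (hind : AlgebraicIndependent ℚ
      (fun z : Fin m × (Fin k ⊕ Fin l) => Sum.elim (E z.1) (D z.1) z.2))
    (a a' : Fin k → ℂ) (b b' : Fin l → ℂ)
    (hc : circConv m (Matrix.of E *ᵥ a) (Matrix.of D *ᵥ b) =
      circConv m (Matrix.of E *ᵥ a') (Matrix.of D *ᵥ b')) :
    ∀ i j, a i * b j = a' i * b' j := by
  by_contra! hne
  obtain ⟨p, q, hpq⟩ := hne
  have hx : a p * b q - a' p * b' q ≠ 0 := sub_ne_zero.mpr hpq
  set x := a p * b q - a' p * b' q with hxdef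
  let Y : Fin k → Fin l → ℂ := fun i j => (a i / x) * b j - (a' i / x) * b' j
  have hYpq : Y p q = 1 := by
    simp only [Y]
    rw [div_mul_eq_mul_div, div_mul_eq_mul_div, ← sub_div, ← hxdef, div_self hx]
  obtain ⟨S0, hS0, hS0'⟩ := lemA k l m hm h (fun i => a i / x) (fun i => a' i / x) b b' Y
    (fun _ _ => rfl) p q hYpq
  have hζ := Complex.isPrimitiveRoot_exp m (by omega)
  set ζ := Complex.exp (2 * Real.pi * Complex.I / m) with hζdef
  let F : Fin m → Fin k → ℂ := fun r c => ∑ j : Fin m, (ζ ^ (r:ℕ)) ^ (j:ℕ) * E j c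
  let G : Fin m → Fin l → ℂ := fun r c => ∑ j : Fin m, (ζ ^ (r:ℕ)) ^ (j:ℕ) * D j c
  have hFa : ∀ (r : Fin m) (a : Fin k → ℂ), ∑ j : Fin m, (ζ ^ (r:ℕ)) ^ (j:ℕ) * (Matrix.of E *ᵥ a) j =
      ∑ i, F r i * a i := by
    intro r a
    simp only [F, Matrix.mulVec, dotProduct, Matrix.of_apply, Finset.mul_sum, Finset.sum_mul]
    rw [Finset.sum_comm]
    simp only [mul_assoc]
  have hGb : ∀ (r : Fin m) (b : Fin l → ℂ), ∑ j : Fin m, (ζ ^ (r:ℕ)) ^ (j:ℕ) * (Matrix.of D *ᵥ b) j =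
      ∑ i, G r i * b i := by
    intro r a
    simp only [G, Matrix.mulVec, dotProduct, Matrix.of_apply, Finset.mul_sum, Finset.sum_mul]
    rw [Finset.sum_comm]
    simp only [mul_assoc]
  have hprod : ∀ r : Fin m, (∑ i, F r i * a i) * (∑ j, G r j * b j) =
      (∑ i, F r i * a' i) * (∑ j, G r j * b' j) := by
    intro r
    have hz : (ζ ^ (r:ℕ)) ^ m = 1 := by
      rw [← pow_mul, mul_comm, pow_mul, hζ.pow_eq_one, one_pow]
    have hz0 : ζ ^ (r:ℕ) ≠ 0 := pow_ne_zero _ (hζ.ne_zero (by omega))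
    have h1 := dft_conv m _ hz (Matrix.of E *ᵥ a) (Matrix.of D *ᵥ b)
    have h2 := dft_conv m _ hz (Matrix.of E *ᵥ a') (Matrix.of D *ᵥ b')
    rw [hc, h2, hFa, hFa, hGb, hGb, mul_assoc, mul_assoc] at h1
    exact (mul_left_cancel₀ hz0 h1).symm
  have hzero : ∀ r : Fin m, ∑ i, F r i * ∑ j, Y i j * G r j = 0 := by
    intro r
    have : ∑ i, F r i * ∑ j, Y i j * G r j = ((∑ i, F r i * a i) * (∑ j, G r j * b j) -
      (∑ i, F r i * a' i) * (∑ j, G r j * b' j)) / x := by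
      rw [Finset.sum_mul_sum, Finset.sum_mul_sum, ← Finset.sum_sub_distrib, Finset.sum_div]
      simp only [← Finset.sum_sub_distrib, Finset.sum_div, Finset.mul_sum, Y]
      refine Finset.sum_congr rfl fun i _ => Finset.sum_congr rfl fun j _ => ?_
      ring
    rw [this, hprod r, sub_self, zero_div]
  choose T hT hT' using fun r => lemB k l Y p q hYpq (F r) (G r) (hzero r)
  let S : Finset ℂ := S0 ∪ Finset.univ.biUnion T
  have hScard : S.card < m * (k + l) := by
    have h1 : (Finset.univ.biUnion T).card ≤ m * (k + l - 1) := by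
      refine Finset.card_biUnion_le.trans ?_
      refine (Finset.sum_le_sum fun r _ => hT r).trans ?_
      simp
    have h2 := Finset.card_union_le S0 (Finset.univ.biUnion T)
    have hk := p.pos
    obtain ⟨n, hn⟩ : ∃ n, k + l = n + 1 := ⟨k + l - 1, by omega⟩
    rw [hn] at h1 ⊢
    rw [mul_add, mul_one]
    simp only [Nat.add_sub_cancel] at h1
    change (S0 ∪ Finset.univ.biUnion T).card < _
    omega
  let L := algCl (S : Set ℂ)
  have hSL : ∀ s ∈ S, s ∈ L := by
    intro s hs
    rw [mem_algCl]
    exact isAlgebraic_algebraMap (⟨s, Algebra.subset_adjoin hs⟩ : Algebra.adjoin ℚ (S : Set ℂ))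
  have hζL : ζ ∈ L := by
    rw [mem_algCl]
    have : IsIntegral (Algebra.adjoin ℚ (S : Set ℂ)) ζ := hζ.isIntegral (by omega) |>.tower_top
    exact this.isAlgebraic
  have hYL := hS0' L fun s hs => hSL s (Finset.mem_union_left _ hs)
  have hFG := fun r => hT' r L hYL fun s hs => hSL s
    (Finset.mem_union_right _ (Finset.mem_biUnion.mpr ⟨r, Finset.mem_univ _, hs⟩))
  have hE : ∀ j c, E j c ∈ L := fun j c =>
    dft_inv m hm ζ hζ (fun j => E j c) L hζL (fun r => (hFG r).1 c) j
  have hD : ∀ j c, D j c ∈ L := fun j c =>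
    dft_inv m hm ζ hζ (fun j => D j c) L hζL (fun r => (hFG r).2 c) j
  have := lemC _ hind S (by
    rintro ⟨i, j | j⟩
    · exact hE i j
    · exact hD i j)
  simp only [Fintype.card_prod, Fintype.card_sum, Fintype.card_fin] at this
  omega

theorem stmt3 (m k l : ℕ) (hk : 1 ≤ k) (hl : 1 ≤ l) (h : 2 * (k + l) - 4 ≤ m) :
    ∀ᵐ ED ∂(volume : Measure ((Fin m → Fin k → ℂ) × (Fin m → Fin l → ℂ))),
      StrongIdent
        {q : (Fin m → ℂ) × (Fin m → ℂ) |
          (∃ a : Fin k → ℂ, q.1 = Matrix.of ED.1 *ᵥ a) ∧ q.1 ≠ 0 ∧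
          (∃ b : Fin l → ℂ, q.2 = Matrix.of ED.2 *ᵥ b) ∧ q.2 ≠ 0}
        (circConv m) := by
  filter_upwards [ae_final m k l] with ED hind
  rintro ⟨v, w⟩ ⟨⟨a, ha⟩, hv, ⟨b, hb⟩, hw⟩ ⟨v', w'⟩ ⟨⟨a', ha'⟩, hv', ⟨b', hb'⟩, hw'⟩ hc
  simp only at ha hb ha' hb' hv hw hv' hw' hc ⊢
  subst ha hb ha' hb'
  have hm : 1 ≤ m := by
    rcases Nat.eq_zero_or_pos m with h0 | h0
    · subst h0
      exact absurd (Subsingleton.elim _ _) hv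
    · exact h0
  have ha0 : a ≠ 0 := by rintro rfl; exact hv (Matrix.mulVec_zero _)
  have hb0 : b ≠ 0 := by rintro rfl; exact hw (Matrix.mulVec_zero _)
  obtain ⟨c, hc0, h1, h2⟩ := scale_of_outer a a' b b' ha0 hb0
    (core_s3 m k l hm h ED.1 ED.2 hind a a' b b' hc)
  exact ⟨c, hc0, by rw [h1, Matrix.mulVec_smul], by rw [h2, Matrix.mulVec_smul]⟩
end
end

section
/- Let s₁,s₂ ≥ 1 be such that 2(s₁+s₂)−2 ≤ m, and let k,l ∈ ℕ satisfy s₁ < k ≤ m and s₂ < l ≤ m. Then for Lebesgue-almost every pair of matrices (E,D) ∈ M(m,k) × M(m,l), the set (ran(E)_{s₁} ∖ {0}) × (ran(D)_{s₂} ∖ {0}) is strongly identifiable modulo scaling with respect to the circular convolution map C : ℂ^m × ℂ^m → ℂ^m, C(v,w) = v ⊛ w. -/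
noncomputable section

open MeasureTheory Matrix

lemma conv_hat (m : ℕ) (z : ℂ) (hz : z ^ m = 1) (v w : Fin m → ℂ) :
    ∑ i : Fin m, z ^ (i : ℕ) * circConv m v w i
      = z * (∑ i : Fin m, z ^ (i : ℕ) * v i) * (∑ i : Fin m, z ^ (i : ℕ) * w i) := by
  have key : ∀ j : Fin m, ∑ i : Fin m, z ^ (i : ℕ) *
      w ⟨(m + i.val - j.val - 1) % m, Nat.mod_lt _ i.pos⟩
      = z ^ ((j : ℕ) + 1) * ∑ n : Fin m, z ^ (n : ℕ) * w n := by
    intro j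
    rw [Finset.mul_sum]
    have hinj : Function.Injective (fun i : Fin m =>
        (⟨(m + i.val - j.val - 1) % m, Nat.mod_lt _ i.pos⟩ : Fin m)) := by
      intro x y hxy
      have h1 : (m + x.val - j.val - 1) % m = (m + y.val - j.val - 1) % m := by
        simpa using hxy
      have h2 : (m + x.val - j.val - 1) ≡ (m + y.val - j.val - 1) [MOD m] := h1
      have h3 := h2.add_right (j.val + 1)
      have e1 : m + x.val - j.val - 1 + (j.val + 1) = m + x.val := by omega
      have e2 : m + y.val - j.val - 1 + (j.val + 1) = m + y.val := by omega
      rw [e1, e2] at h3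
      have h4 : x.val ≡ y.val [MOD m] := Nat.ModEq.add_left_cancel' m h3
      exact Fin.ext (h4.eq_of_lt_of_lt x.2 y.2)
    have hbij := Finite.injective_iff_bijective.mp hinj
    rw [← hbij.sum_comp (fun n : Fin m => z ^ ((j : ℕ) + 1) * (z ^ (n : ℕ) * w n))]
    refine Finset.sum_congr rfl fun i _ => ?_
    have hp : ∀ n, z ^ (n % m) = z ^ n := by
      intro n
      conv_rhs => rw [← Nat.mod_add_div n m, pow_add, pow_mul, hz, one_pow, mul_one]
    simp only [hp]
    rw [← mul_assoc, ← pow_add]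
    have e1 : j.val + 1 + (m + i.val - j.val - 1) = m + i.val := by omega
    rw [e1, pow_add, hz, one_mul]
  unfold circConv
  simp_rw [Finset.mul_sum]
  rw [Finset.sum_comm]
  have : ∀ j : Fin m, ∑ i : Fin m, z ^ (i : ℕ) * (v j *
      w ⟨(m + i.val - j.val - 1) % m, Nat.mod_lt _ i.pos⟩)
      = v j * (z ^ ((j : ℕ) + 1) * ∑ n : Fin m, z ^ (n : ℕ) * w n) := by
    intro j
    rw [← key j, Finset.mul_sum]
    exact Finset.sum_congr rfl fun i _ => by ring
  simp_rw [this]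
  rw [← Finset.mul_sum, Finset.sum_mul]
  exact Finset.sum_congr rfl fun i _ => by ring

lemma null_image {F E : Type*} [NormedAddCommGroup F] [NormedSpace ℝ F] [FiniteDimensional ℝ F]
    [NormedAddCommGroup E] [NormedSpace ℝ E] [FiniteDimensional ℝ E] [MeasurableSpace E]
    [BorelSpace E] (μ : Measure E) [μ.IsAddHaarMeasure] (f : F → E) (s : Set F)
    (hf : DifferentiableOn ℝ f s) (h : Module.finrank ℝ F < Module.finrank ℝ E) :
    μ (f '' s) = 0 := by
  obtain ⟨i, hi⟩ := (finrank_le_iff_exists_linearMap (R := ℝ)).1 h.le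
  obtain ⟨p, hp⟩ := i.exists_leftInverse_of_injective (LinearMap.ker_eq_bot.2 hi)
  let P : E →L[ℝ] F := LinearMap.toContinuousLinearMap p
  have hP : ∀ x, P (i x) = x := fun x => by
    have := LinearMap.congr_fun hp x
    simpa [P] using this
  have him : f '' s = (f ∘ P) '' (P ⁻¹' s) := by
    ext y; constructor
    · rintro ⟨x, hx, rfl⟩
      exact ⟨i x, by simpa [hP] using hx, by simp [hP]⟩
    · rintro ⟨x, hx, rfl⟩
      exact ⟨P x, hx, rfl⟩
  rw [him]
  refine addHaar_image_eq_zero_of_det_fderivWithin_eq_zero μ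
    (f' := fun x => (fderivWithin ℝ f s (P x)).comp P) ?_ ?_
  · intro x hx
    exact ((hf (P x) hx).hasFDerivWithinAt).comp x P.hasFDerivAt.hasFDerivWithinAt
      (fun y hy => hy)
  · intro x hx
    by_contra hne
    set L := (fderivWithin ℝ f s (P x)).comp P
    have hinj : Function.Injective (L : E →ₗ[ℝ] E) := by
      rw [← LinearMap.ker_eq_bot]
      by_contra hk
      exact hne (LinearMap.det_eq_zero_iff_ker_ne_bot.2 hk)
    have : Function.Injective p := by
      intro y z hyz
      apply hinj
      show fderivWithin ℝ f s (P x) (p y) = fderivWithin ℝ f s (P x) (p z)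
      rw [hyz]
    exact absurd (LinearMap.finrank_le_finrank_of_injective this) (by omega)

lemma null_image_pi {J E : Type*} [Fintype J] [DecidableEq J]
    [NormedAddCommGroup E] [NormedSpace ℝ E] [FiniteDimensional ℝ E] [MeasurableSpace E]
    [BorelSpace E] (μ : Measure E) [μ.IsAddHaarMeasure] (f : (J → ℂ) → E) (s : Set (J → ℂ))
    (hf : DifferentiableOn ℝ f s) (I : Finset J) (c : J → ℂ)
    (h : 2 * I.card < Module.finrank ℝ E) :
    μ (f '' {x | x ∈ s ∧ ∀ j ∉ I, x j = c j}) = 0 := by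
  let e : (I → ℂ) → (J → ℂ) := fun y j => if h : j ∈ I then y ⟨j, h⟩ else c j
  have he : Differentiable ℝ e := by
    rw [differentiable_pi]
    intro j
    by_cases h : j ∈ I
    · simp only [e, h, dif_pos]; fun_prop
    · simp only [e, h, dif_neg, not_false_eq_true]; fun_prop
  refine measure_mono_null ?_ (null_image μ (f ∘ e) (e ⁻¹' s)
    (hf.comp he.differentiableOn (fun y hy => hy)) ?_)
  · rintro _ ⟨x, ⟨hx, hc⟩, rfl⟩
    have : e (fun j => x j) = x := by
      funext j
      by_cases h : j ∈ I
      · simp [e, h]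
      · simp [e, h, hc]
    exact ⟨fun j => x j, by simpa [this] using hx, by simp [this]⟩
  · rw [Module.finrank_pi_fintype]
    simpa [Complex.finrank_real_complex, mul_comm] using h

theorem haar_pi1 (k : ℕ) : (volume : Measure ((Fin k → ℂ))).IsAddHaarMeasure := inferInstance
theorem haar_pi2 (m k : ℕ) : (volume : Measure ((Fin m → Fin k → ℂ))).IsAddHaarMeasure := by
  have := haar_pi1 k
  exact Measure.pi.isAddHaarMeasure _
theorem haar_prod (m k l : ℕ) :
    (volume : Measure ((Fin m → Fin k → ℂ) × (Fin m → Fin l → ℂ))).IsAddHaarMeasure := by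
  have := haar_pi2 m k
  have := haar_pi2 m l
  exact Measure.prod.instIsAddHaarMeasure _ _

/-- index type of all the parameters -/
abbrev JJ (m k l : ℕ) : Type :=
  (Fin k ⊕ Fin k) ⊕ ((Fin l ⊕ Fin l) ⊕ ((Fin m × Fin k) ⊕ (Fin m × Fin l)))

section
variable {m k l : ℕ}
abbrev xa (x : JJ m k l → ℂ) (j : Fin k) : ℂ := x (.inl (.inl j))
abbrev xa' (x : JJ m k l → ℂ) (j : Fin k) : ℂ := x (.inl (.inr j))
abbrev xb (x : JJ m k l → ℂ) (j : Fin l) : ℂ := x (.inr (.inl (.inl j)))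
abbrev xb' (x : JJ m k l → ℂ) (j : Fin l) : ℂ := x (.inr (.inl (.inr j)))
abbrev xe (x : JJ m k l → ℂ) (i : Fin m) (j : Fin k) : ℂ := x (.inr (.inr (.inl (i, j))))
abbrev xd (x : JJ m k l → ℂ) (i : Fin m) (j : Fin l) : ℂ := x (.inr (.inr (.inr (i, j))))

def Mx (x : JJ m k l → ℂ) (j : Fin k) (t : Fin l) : ℂ := xa x j * xb x t - xa' x j * xb' x t
def Mrow (x : JJ m k l → ℂ) (i : Fin m) (j : Fin k) : ℂ := ∑ t, Mx x j t * xd x i t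

def ff (A : Finset (Fin m)) (j0 : Fin k) (t0 : Fin l) (x : JJ m k l → ℂ) :
    (Fin m → Fin k → ℂ) × (Fin m → Fin l → ℂ) :=
  (fun i j => if i ∈ A ∧ j = j0 then -(∑ j', xe x i j' * Mrow x i j') / Mrow x i j0 else xe x i j,
   fun i t => if i ∉ A ∧ t = t0 then -(∑ t', Mx x j0 t' * xd x i t') / Mx x j0 t0 else xd x i t)

lemma ff_diff (A : Finset (Fin m)) (j0 : Fin k) (t0 : Fin l) :
    DifferentiableOn ℝ (ff A j0 t0)
      {x : JJ m k l → ℂ | Mx x j0 t0 ≠ 0 ∧ ∀ i ∈ A, Mrow x i j0 ≠ 0} := by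
  have hM : ∀ j t, Differentiable ℝ (fun x : JJ m k l → ℂ => Mx x j t) := by
    intro j t; unfold Mx; fun_prop
  have hR : ∀ i j, Differentiable ℝ (fun x : JJ m k l → ℂ => Mrow x i j) := by
    intro j t; unfold Mrow; fun_prop
  intro x hx
  apply DifferentiableAt.differentiableWithinAt
  unfold ff
  apply DifferentiableAt.prodMk
  · rw [differentiableAt_pi]; intro i
    rw [differentiableAt_pi]; intro j
    by_cases h : i ∈ A ∧ j = j0
    · simp only [h, and_self, if_true]
      have := hx.2 i h.1
      have hn : DifferentiableAt ℝ (fun x : JJ m k l → ℂ => -(∑ j', xe x i j' * Mrow x i j')) x := by fun_prop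
      simp only [div_eq_mul_inv]
      exact hn.fun_mul (DifferentiableAt.fun_inv (hR i j0 x) this)
    · simp only [h, if_false]; fun_prop
  · rw [differentiableAt_pi]; intro i
    rw [differentiableAt_pi]; intro j
    by_cases h : i ∉ A ∧ j = t0
    · simp only [h, not_false_eq_true, and_self, if_true]
      have := hx.1
      have hn : DifferentiableAt ℝ (fun x : JJ m k l → ℂ => -(∑ t', Mx x j0 t' * xd x i t')) x := by fun_prop
      simp only [div_eq_mul_inv]
      exact hn.fun_mul (DifferentiableAt.fun_inv (hM j0 t0 x) this)
    · simp only [h, if_false]; fun_prop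

def II (S S' : Finset (Fin k)) (T T' : Finset (Fin l)) (p q : Fin k) (r : Fin l)
    (A : Finset (Fin m)) (j0 : Fin k) (t0 : Fin l) : Finset (JJ m k l) :=
  ((S.erase p).disjSum (S'.erase q)).disjSum (((T.erase r).disjSum T').disjSum
    ((A ×ˢ {j0})ᶜ.disjSum (Aᶜ ×ˢ {t0})ᶜ))

lemma II_card (S S' : Finset (Fin k)) (T T' : Finset (Fin l)) (p q : Fin k) (r : Fin l)
    (A : Finset (Fin m)) (j0 : Fin k) (t0 : Fin l) (hp : p ∈ S) (hq : q ∈ S') (hr : r ∈ T)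
    (s₁ s₂ : ℕ) (hS : S.card ≤ s₁) (hS' : S'.card ≤ s₁) (hT : T.card ≤ s₂) (hT' : T'.card ≤ s₂)
    (hm : 2 * (s₁ + s₂) - 2 ≤ m) :
    (II S S' T T' p q r A j0 t0).card < m * k + m * l := by
  have h1 := Finset.card_pos.2 ⟨p, hp⟩
  have h2 := Finset.card_pos.2 ⟨q, hq⟩
  have h3 := Finset.card_pos.2 ⟨r, hr⟩
  have hA : A.card ≤ m := by simpa using A.card_le_univ
  have h4 : A.card * 1 ≤ m * k := Nat.mul_le_mul hA (by have := j0.2; omega)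
  have h5 : (m - A.card) * 1 ≤ m * l := Nat.mul_le_mul (by omega) (by have := t0.2; omega)
  simp only [II, Finset.card_disjSum, Finset.card_compl, Finset.card_product,
    Finset.card_singleton, Finset.card_erase_of_mem hp, Finset.card_erase_of_mem hq,
    Finset.card_erase_of_mem hr, Fintype.card_prod, Fintype.card_fin]
  omega

def cc (p q : Fin k) (r : Fin l) : JJ m k l → ℂ :=
  Sum.elim (Sum.elim (fun j => if j = p then 1 else 0) (fun j => if j = q then 1 else 0))
    (Sum.elim (Sum.elim (fun j => if j = r then 1 else 0) 0) 0)

def Bad (m k l s₁ s₂ : ℕ) : Set ((Fin m → Fin k → ℂ) × (Fin m → Fin l → ℂ)) :=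
  {ed | ∃ (a a' : Fin k → ℂ) (b b' : Fin l → ℂ), Sparse s₁ a ∧ Sparse s₁ a' ∧ Sparse s₂ b ∧
    Sparse s₂ b' ∧ a ≠ 0 ∧ a' ≠ 0 ∧ b ≠ 0 ∧ (∃ j t, a j * b t - a' j * b' t ≠ 0) ∧
    ∀ i, (∑ j, ed.1 i j * a j) * (∑ t, ed.2 i t * b t)
      = (∑ j, ed.1 i j * a' j) * (∑ t, ed.2 i t * b' t)}

/-- normalized version -/
lemma bad_sub (S S' : Finset (Fin k)) (T T' : Finset (Fin l)) (p q : Fin k) (r : Fin l)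
    (j0 : Fin k) (t0 : Fin l) (a a' : Fin k → ℂ) (b b' : Fin l → ℂ)
    (ha : ∀ j ∉ S, a j = 0) (ha' : ∀ j ∉ S', a' j = 0)
    (hb : ∀ j ∉ T, b j = 0) (hb' : ∀ j ∉ T', b' j = 0)
    (hp : a p = 1) (hq : a' q = 1) (hr : b r = 1)
    (hpS : p ∈ S) (hqS : q ∈ S') (hrS : r ∈ T)
    (h0 : a j0 * b t0 - a' j0 * b' t0 ≠ 0)
    (ed : (Fin m → Fin k → ℂ) × (Fin m → Fin l → ℂ))
    (h : ∀ i, (∑ j, ed.1 i j * a j) * (∑ t, ed.2 i t * b t)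
      = (∑ j, ed.1 i j * a' j) * (∑ t, ed.2 i t * b' t)) :
    ∃ A, ed ∈ ff A j0 t0 ''
      {x : JJ m k l → ℂ | x ∈ {x : JJ m k l → ℂ | Mx x j0 t0 ≠ 0 ∧ ∀ i ∈ A, Mrow x i j0 ≠ 0} ∧
        ∀ j ∉ II S S' T T' p q r A j0 t0, x j = cc p q r j} := by
  classical
  let R : Fin m → Fin k → ℂ := fun i j => ∑ t, (a j * b t - a' j * b' t) * ed.2 i t
  have hR : ∀ i, ∑ j, ed.1 i j * R i j = 0 := by
    intro i
    have : ∀ j, R i j = a j * (∑ t, ed.2 i t * b t) - a' j * (∑ t, ed.2 i t * b' t) := by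
      intro j
      simp only [R, Finset.mul_sum, ← Finset.sum_sub_distrib]
      exact Finset.sum_congr rfl fun t _ => by ring
    simp_rw [this, mul_sub, Finset.sum_sub_distrib, ← mul_assoc, ← Finset.sum_mul]
    rw [h i, sub_self]
  let A : Finset (Fin m) := Finset.univ.filter fun i => R i j0 ≠ 0
  have hA : ∀ i, i ∈ A ↔ R i j0 ≠ 0 := fun i => by simp [A]
  let x : JJ m k l → ℂ := Sum.elim (Sum.elim a a') (Sum.elim (Sum.elim b b')
    (Sum.elim (fun ij => if ij.1 ∈ A ∧ ij.2 = j0 then 0 else ed.1 ij.1 ij.2)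
      (fun ij => if ij.1 ∉ A ∧ ij.2 = t0 then 0 else ed.2 ij.1 ij.2)))
  have hMx : ∀ j t, Mx x j t = a j * b t - a' j * b' t := fun j t => rfl
  have hrow : ∀ i ∈ A, ∀ j, Mrow x i j = R i j := by
    intro i hi j
    simp only [Mrow, hMx, R]
    refine Finset.sum_congr rfl fun t _ => ?_
    simp [x, hi]
  refine ⟨A, x, ⟨⟨by rw [hMx]; exact h0, fun i hi => by rw [hrow i hi]; exact (hA i).1 hi⟩, ?_⟩, ?_⟩
  · rintro ((j | j) | ((j | j) | (⟨i, j⟩ | ⟨i, j⟩))) hj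
    · simp only [II, Finset.inl_mem_disjSum, Finset.mem_erase, not_and] at hj
      by_cases hjp : j = p
      · subst hjp; simp [x, cc, hp]
      · simp [x, cc, hjp, ha j (hj hjp)]
    · simp only [II, Finset.inl_mem_disjSum, Finset.inr_mem_disjSum, Finset.mem_erase, not_and] at hj
      by_cases hjp : j = q
      · subst hjp; simp [x, cc, hq]
      · simp [x, cc, hjp, ha' j (hj hjp)]
    · simp only [II, Finset.inl_mem_disjSum, Finset.inr_mem_disjSum, Finset.mem_erase, not_and] at hj
      by_cases hjp : j = r
      · subst hjp; simp [x, cc, hr]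
      · simp [x, cc, hjp, hb j (hj hjp)]
    · simp only [II, Finset.inl_mem_disjSum, Finset.inr_mem_disjSum] at hj
      simp [x, cc, hb' j hj]
    · simp only [II, Finset.inl_mem_disjSum, Finset.inr_mem_disjSum, Finset.mem_compl,
        Finset.mem_product, Finset.mem_singleton, not_not] at hj
      simp [x, cc, hj]
    · simp only [II, Finset.inr_mem_disjSum, Finset.mem_compl,
        Finset.mem_product, Finset.mem_singleton, not_not] at hj
      simp [x, cc, hj]
  · refine Prod.ext ?_ ?_
    · funext i j
      simp only [ff]
      split_ifs with hij
      · obtain ⟨hi, rfl⟩ := hij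
        have hne := (hA i).1 hi
        simp only [hrow i hi]
        rw [div_eq_iff hne]
        have h1 := hR i
        rw [← Finset.add_sum_erase _ _ (Finset.mem_univ j)] at h1
        rw [← Finset.add_sum_erase _ _ (Finset.mem_univ j)]
        have h2 : xe x i j = 0 := by simp [x, hi]
        have h3 : ∑ j' ∈ Finset.univ.erase j, xe x i j' * R i j'
            = ∑ j' ∈ Finset.univ.erase j, ed.1 i j' * R i j' := by
          refine Finset.sum_congr rfl fun t ht => ?_
          simp [x, Finset.ne_of_mem_erase ht]
        rw [h2, h3]
        linear_combination -h1
      · simp only [x, Sum.elim_inr, Sum.elim_inl, hij, if_false]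
    · funext i t
      simp only [ff]
      split_ifs with hij
      · obtain ⟨hi, rfl⟩ := hij
        have h1 : R i j0 = 0 := by simpa using (hA i).not.1 hi
        rw [div_eq_iff (by rw [hMx]; exact h0)]
        simp only [R] at h1
        simp only [hMx]
        rw [← Finset.add_sum_erase _ _ (Finset.mem_univ t)] at h1
        rw [← Finset.add_sum_erase _ _ (Finset.mem_univ t)]
        have h2 : xd x i t = 0 := by simp [x, hi]
        have h3 : ∑ t' ∈ Finset.univ.erase t, (a j0 * b t' - a' j0 * b' t') * xd x i t'
            = ∑ t' ∈ Finset.univ.erase t, (a j0 * b t' - a' j0 * b' t') * ed.2 i t' := by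
          refine Finset.sum_congr rfl fun t ht => ?_
          simp [x, Finset.ne_of_mem_erase ht]
        rw [h2, h3]
        linear_combination -h1
      · simp only [x, Sum.elim_inr, hij, if_false]

def supp {n : ℕ} (u : Fin n → ℂ) : Finset (Fin n) := Finset.univ.filter fun i => u i ≠ 0

lemma mem_supp {n : ℕ} (u : Fin n → ℂ) (i : Fin n) : i ∈ supp u ↔ u i ≠ 0 := by simp [supp]

lemma card_supp {n s : ℕ} {u : Fin n → ℂ} (h : Sparse s u) : (supp u).card ≤ s := by
  unfold Sparse at h
  rw [← Set.ncard_coe_finset]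
  convert h using 2
  ext i; simp [supp]

lemma null_bad (m k l s₁ s₂ : ℕ) (hm : 2 * (s₁ + s₂) - 2 ≤ m) :
    volume (Bad m k l s₁ s₂) = 0 := by
  classical
  have hμ := haar_prod m k l
  let U : Set ((Fin m → Fin k → ℂ) × (Fin m → Fin l → ℂ)) :=
    ⋃ (w : (Finset (Fin k) × Finset (Fin k)) × (Finset (Fin l) × Finset (Fin l)) ×
        (Fin k × Fin k × Fin l) × (Fin k × Fin l) × Finset (Fin m)),
      ⋃ (_ : (w.1.1.card ≤ s₁ ∧ w.1.2.card ≤ s₁ ∧ w.2.1.1.card ≤ s₂ ∧ w.2.1.2.card ≤ s₂) ∧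
        w.2.2.1.1 ∈ w.1.1 ∧ w.2.2.1.2.1 ∈ w.1.2 ∧ w.2.2.1.2.2 ∈ w.2.1.1),
      ff w.2.2.2.2 w.2.2.2.1.1 w.2.2.2.1.2 ''
      {x : JJ m k l → ℂ | x ∈ {x : JJ m k l → ℂ | Mx x w.2.2.2.1.1 w.2.2.2.1.2 ≠ 0 ∧
          ∀ i ∈ w.2.2.2.2, Mrow x i w.2.2.2.1.1 ≠ 0} ∧
        ∀ j ∉ II w.1.1 w.1.2 w.2.1.1 w.2.1.2 w.2.2.1.1 w.2.2.1.2.1 w.2.2.1.2.2 w.2.2.2.2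
          w.2.2.2.1.1 w.2.2.2.1.2, x j = cc w.2.2.1.1 w.2.2.1.2.1 w.2.2.1.2.2 j}
  have hU : volume U = 0 := by
    rw [measure_iUnion_null_iff]
    rintro ⟨⟨S, S'⟩, ⟨T, T'⟩, ⟨p, q, r⟩, ⟨j0, t0⟩, A⟩
    rw [measure_iUnion_null_iff]
    rintro ⟨⟨h1, h2, h3, h4⟩, hp, hq, hr⟩
    refine null_image_pi volume _ _ (ff_diff A j0 t0) _ _ ?_
    have := II_card S S' T T' p q r A j0 t0 hp hq hr s₁ s₂ h1 h2 h3 h4 hm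
    have hE : Module.finrank ℝ ((Fin m → Fin k → ℂ) × (Fin m → Fin l → ℂ))
        = 2 * (m * k + m * l) := by
      simp [Module.finrank_prod, Module.finrank_pi_fintype, Complex.finrank_real_complex]
      ring
    rw [hE]; dsimp only; omega
  refine measure_mono_null ?_ hU
  rintro ed ⟨a, a', b, b', sa, sa', sb, sb', na, na', nb, ⟨j0, t0, h0⟩, h⟩
  obtain ⟨p, hp⟩ := Function.ne_iff.1 na
  obtain ⟨q, hq⟩ := Function.ne_iff.1 na'
  obtain ⟨r, hr⟩ := Function.ne_iff.1 nb
  simp only [Pi.zero_apply] at hp hq hr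
  obtain ⟨A, hA⟩ := bad_sub (supp a) (supp a') (supp b) (supp b') p q r j0 t0
    (fun j => a j / a p) (fun j => a' j / a' q) (fun t => b t / b r)
    (fun t => a' q / (a p * b r) * b' t)
    (by intro j hj; rw [mem_supp, not_not] at hj; simp [hj])
    (by intro j hj; rw [mem_supp, not_not] at hj; simp [hj])
    (by intro j hj; rw [mem_supp, not_not] at hj; simp [hj])
    (by intro j hj; rw [mem_supp, not_not] at hj; simp [hj])
    (div_self hp) (div_self hq) (div_self hr)
    ((mem_supp _ _).2 hp) ((mem_supp _ _).2 hq) ((mem_supp _ _).2 hr)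
    (by
      have : a j0 / a p * (b t0 / b r) - a' j0 / a' q * (a' q / (a p * b r) * b' t0)
        = (a j0 * b t0 - a' j0 * b' t0) / (a p * b r) := by field_simp
      rw [this]
      exact div_ne_zero h0 (mul_ne_zero hp hr)) ed
    (by
      intro i
      have e1 : ∑ j, ed.1 i j * (a j / a p) = (∑ j, ed.1 i j * a j) / a p := by
        rw [Finset.sum_div]; exact Finset.sum_congr rfl fun _ _ => by ring
      have e2 : ∑ j, ed.1 i j * (a' j / a' q) = (∑ j, ed.1 i j * a' j) / a' q := by
        rw [Finset.sum_div]; exact Finset.sum_congr rfl fun _ _ => by ring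
      have e3 : ∑ j, ed.2 i j * (b j / b r) = (∑ j, ed.2 i j * b j) / b r := by
        rw [Finset.sum_div]; exact Finset.sum_congr rfl fun _ _ => by ring
      have e4 : ∑ j, ed.2 i j * (a' q / (a p * b r) * b' j)
          = a' q / (a p * b r) * (∑ j, ed.2 i j * b' j) := by
        rw [Finset.mul_sum]; exact Finset.sum_congr rfl fun _ _ => by ring
      rw [e1, e2, e3, e4]
      have := h i
      field_simp
      linear_combination this)
  refine Set.mem_iUnion.2 ⟨⟨⟨supp a, supp a'⟩, ⟨supp b, supp b'⟩, ⟨p, q, r⟩, ⟨j0, t0⟩, A⟩, ?_⟩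
  refine Set.mem_iUnion.2 ⟨⟨⟨card_supp sa, card_supp sa', card_supp sb, card_supp sb'⟩,
    (mem_supp _ _).2 hp, (mem_supp _ _).2 hq, (mem_supp _ _).2 hr⟩, hA⟩

end

/-- left multiplication of both matrices -/
def LM (m k l : ℕ) (W : Matrix (Fin m) (Fin m) ℂ) :
    ((Fin m → Fin k → ℂ) × (Fin m → Fin l → ℂ)) →ₗ[ℝ]
      ((Fin m → Fin k → ℂ) × (Fin m → Fin l → ℂ)) where
  toFun ed := (W * Matrix.of ed.1, W * Matrix.of ed.2)
  map_add' x y := by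
    refine Prod.ext ?_ ?_
    · exact Matrix.mul_add W (Matrix.of x.1) (Matrix.of y.1)
    · exact Matrix.mul_add W (Matrix.of x.2) (Matrix.of y.2)
  map_smul' c x := by
    refine Prod.ext ?_ ?_
    · exact Matrix.mul_smul W c (Matrix.of x.1)
    · exact Matrix.mul_smul W c (Matrix.of x.2)

theorem stmt4 (m k l s₁ s₂ : ℕ) (hs₁ : 1 ≤ s₁) (hs₂ : 1 ≤ s₂)
    (hm : 2 * (s₁ + s₂) - 2 ≤ m) (hk : s₁ < k) (hkm : k ≤ m) (hl : s₂ < l) (hlm : l ≤ m) :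
    ∀ᵐ ED ∂(volume : Measure ((Fin m → Fin k → ℂ) × (Fin m → Fin l → ℂ))),
      StrongIdent
        {q : (Fin m → ℂ) × (Fin m → ℂ) |
          (∃ a : Fin k → ℂ, Sparse s₁ a ∧ q.1 = Matrix.of ED.1 *ᵥ a) ∧ q.1 ≠ 0 ∧
          (∃ b : Fin l → ℂ, Sparse s₂ b ∧ q.2 = Matrix.of ED.2 *ᵥ b) ∧ q.2 ≠ 0}
        (circConv m) := by
  have hμ := haar_prod m k l
  have hm0 : m ≠ 0 := by omega
  have hω := Complex.isPrimitiveRoot_exp m hm0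
  set ω := Complex.exp (2 * Real.pi * Complex.I / m) with hωdef
  let W : Matrix (Fin m) (Fin m) ℂ := Matrix.vandermonde fun i : Fin m => ω ^ (i : ℕ)
  have hW : W.det ≠ 0 := by
    rw [Matrix.det_vandermonde_ne_zero_iff]
    intro i j hij
    exact Fin.ext (hω.pow_inj i.2 j.2 hij)
  have hWu : W⁻¹ * W = 1 := Matrix.nonsing_inv_mul _ (isUnit_iff_ne_zero.2 hW)
  have hz : ∀ i : Fin m, (ω ^ (i : ℕ)) ^ m = 1 := by
    intro i
    rw [← pow_mul, mul_comm, pow_mul, hω.pow_eq_one, one_pow]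
  have hω0 : ω ≠ 0 := hω.ne_zero hm0
  have hnull : volume (LM m k l W⁻¹ '' Bad m k l s₁ s₂) = 0 := by
    rw [Measure.addHaar_image_linearMap, null_bad m k l s₁ s₂ hm, mul_zero]
  rw [ae_iff]
  refine measure_mono_null ?_ hnull
  intro ED hED
  refine ⟨LM m k l W ED, ?_, ?_⟩
  swap
  · refine Prod.ext ?_ ?_
    · show W⁻¹ * (W * Matrix.of ED.1) = Matrix.of ED.1
      rw [← Matrix.mul_assoc, hWu, Matrix.one_mul]
    · show W⁻¹ * (W * Matrix.of ED.2) = Matrix.of ED.2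
      rw [← Matrix.mul_assoc, hWu, Matrix.one_mul]
  by_contra hnb
  apply hED
  rintro ⟨u, v⟩ ⟨⟨a, sa, ha⟩, hu, ⟨b, sb, hb⟩, hv⟩ ⟨u', v'⟩ ⟨⟨a', sa', ha'⟩, hu', ⟨b', sb', hb'⟩, hv'⟩ hc
  simp only at ha hb ha' hb' hu hv hu' hv' hc ⊢
  have na : a ≠ 0 := by rintro rfl; exact hu (by rw [ha, Matrix.mulVec_zero])
  have na' : a' ≠ 0 := by rintro rfl; exact hu' (by rw [ha', Matrix.mulVec_zero])
  have nb : b ≠ 0 := by rintro rfl; exact hv (by rw [hb, Matrix.mulVec_zero])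
  have nb' : b' ≠ 0 := by rintro rfl; exact hv' (by rw [hb', Matrix.mulVec_zero])
  have key : ∀ j t, a j * b t = a' j * b' t := by
    by_contra hne
    push Not at hne
    obtain ⟨j, t, hjt⟩ := hne
    apply hnb
    refine ⟨a, a', b, b', sa, sa', sb, sb', na, na', nb, ⟨j, t, sub_ne_zero.2 hjt⟩, ?_⟩
    intro i
    have t1 : ∀ c : Fin k → ℂ, ∑ j, (LM m k l W ED).1 i j * c j
        = ∑ n : Fin m, (ω ^ (i : ℕ)) ^ (n : ℕ) * (Matrix.of ED.1 *ᵥ c) n := by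
      intro c
      show ((W * Matrix.of ED.1) *ᵥ c) i = (W *ᵥ (Matrix.of ED.1 *ᵥ c)) i
      rw [Matrix.mulVec_mulVec]
    have t2 : ∀ c : Fin l → ℂ, ∑ j, (LM m k l W ED).2 i j * c j
        = ∑ n : Fin m, (ω ^ (i : ℕ)) ^ (n : ℕ) * (Matrix.of ED.2 *ᵥ c) n := by
      intro c
      show ((W * Matrix.of ED.2) *ᵥ c) i = (W *ᵥ (Matrix.of ED.2 *ᵥ c)) i
      rw [Matrix.mulVec_mulVec]
    rw [t1, t1, t2, t2, ← ha, ← ha', ← hb, ← hb']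
    have c1 := conv_hat m _ (hz i) u v
    have c2 := conv_hat m _ (hz i) u' v'
    rw [hc, c2, mul_assoc, mul_assoc] at c1
    exact (mul_left_cancel₀ (pow_ne_zero _ hω0) c1).symm
  obtain ⟨r, hr⟩ := Function.ne_iff.1 nb
  obtain ⟨p, hp⟩ := Function.ne_iff.1 na
  simp only [Pi.zero_apply] at hp hr
  have hr' : b' r ≠ 0 := by
    intro h
    have := key p r
    rw [h, mul_zero] at this
    exact mul_ne_zero hp hr this
  have hp' : a' p ≠ 0 := by
    intro h
    have := key p r
    rw [h, zero_mul] at this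
    exact mul_ne_zero hp hr this
  have e1 : a = (b' r / b r) • a' := by
    funext j
    have := key j r
    simp only [Pi.smul_apply, smul_eq_mul]
    field_simp
    linear_combination this
  have e2 : b = (b' r / b r)⁻¹ • b' := by
    funext t
    have h1 := key p t
    have h2 := key p r
    simp only [Pi.smul_apply, smul_eq_mul]
    field_simp
    apply mul_left_cancel₀ hp
    apply mul_left_cancel₀ hp'
    linear_combination (a' p * b' r) * h1 - (a' p * b' t) * h2
  refine ⟨b' r / b r, div_ne_zero hr' hr, ?_, ?_⟩
  · rw [ha, ha', ← Matrix.mulVec_smul, ← e1]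
  · rw [hb, hb', ← Matrix.mulVec_smul, ← e2]
end
end
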